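/- arXiv:2508.01528 — 2 statements merged into one kernel-verified Lean document; each statement's English description precedes it below -/
import Mathlib

section
/- Let Ω ⊂ ℝⁿ be open and bounded with C² boundary, let p > 2, let λ > 0, and let f : cl(Ω) → ℝ be Lipschitz, nonnegative, and vanishing on ∂Ω. Let u^ε ∈ C²(Ω) ∩ C(cl(Ω)) be the maximal solution of the state-constraint problem for λu + |Du|^p − εΔu = f (a classical solution in Ω, a viscosity supersolution on cl(Ω), satisfying liminf_{Ω∋x→x₀} (u^ε(x) − u^ε(x₀))/|x−x₀|^{α_p} < 0 for every x₀ ∈ ∂Ω), and let u ∈ C(cl(Ω)) be the state-constraint viscosity solution of λu + |Du|^p = f. Set Λ' = 2^{α_p}/α_p + (1 + (n+2)·((osc_Ω f)^{1/p}·‖f‖_Lip)^{1/2})/λ. Then for all sufficiently small ε > 0, max_{x ∈ cl(Ω)} (u^ε(x) − u(x)) ≤ Λ'·ε^{1/2}. -/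
open Set Metric Filter Topology Bornology MeasureTheory NNReal ENNReal

noncomputable section

/-- Distance to the boundary of `Ω`. -/
def dBdry {n : ℕ} (Ω : Set (EuclideanSpace ℝ (Fin n))) (x : EuclideanSpace ℝ (Fin n)) : ℝ :=
  Metric.infDist x (frontier Ω)

/-- The Laplacian of a real-valued function, as the trace of its second derivative. -/
def lapl {n : ℕ} (φ : EuclideanSpace ℝ (Fin n) → ℝ) (x : EuclideanSpace ℝ (Fin n)) : ℝ :=
  ∑ i : Fin n, fderiv ℝ (fderiv ℝ φ) x (EuclideanSpace.single i 1) (EuclideanSpace.single i 1)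

/-- The constant `δ_Ω`: one third of the supremum of those `δ` (below the inradius) such that
the boundary-distance function is `C²`-smooth on `Ω ∖ Ω_δ = {x ∈ Ω : d_∂Ω(x) ≤ δ}`. -/
def deltaOm {n : ℕ} (Ω : Set (EuclideanSpace ℝ (Fin n))) : ℝ :=
  (1 / 3) * sSup {δ : ℝ | 0 < δ ∧ δ < sSup (dBdry Ω '' Ω) ∧
    ContDiffOn ℝ 2 (dBdry Ω) {x ∈ Ω | dBdry Ω x ≤ δ}}

/-- Oscillation of `f` over `s`: `sup_s f − inf_s f`. -/
def oscOn {n : ℕ} (f : EuclideanSpace ℝ (Fin n) → ℝ) (s : Set (EuclideanSpace ℝ (Fin n))) : ℝ :=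
  sSup (f '' s) - sInf (f '' s)

/-- Viscosity subsolution of `λu + |Du|^p − ε·Δu = w` in `Ω` (with `C²` test functions). -/
def ViscSubIn {n : ℕ} (Ω : Set (EuclideanSpace ℝ (Fin n))) (lam p ε : ℝ)
    (w u : EuclideanSpace ℝ (Fin n) → ℝ) : Prop :=
  ∀ x₀ ∈ Ω, ∀ φ : EuclideanSpace ℝ (Fin n) → ℝ, ContDiff ℝ 2 φ →
    IsLocalMaxOn (fun x => u x - φ x) Ω x₀ →
    lam * u x₀ + ‖gradient φ x₀‖ ^ p - ε * lapl φ x₀ - w x₀ ≤ 0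

/-- Viscosity supersolution of `λv + |Dv|^p − ε·Δv = w` on `closure Ω` (`C²` test functions). -/
def ViscSupOn {n : ℕ} (Ω : Set (EuclideanSpace ℝ (Fin n))) (lam p ε : ℝ)
    (w v : EuclideanSpace ℝ (Fin n) → ℝ) : Prop :=
  ∀ x₀ ∈ closure Ω, ∀ φ : EuclideanSpace ℝ (Fin n) → ℝ, ContDiff ℝ 2 φ →
    IsLocalMinOn (fun x => v x - φ x) (closure Ω) x₀ →
    0 ≤ lam * v x₀ + ‖gradient φ x₀‖ ^ p - ε * lapl φ x₀ - w x₀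

/-- First-order (`ε = 0`) viscosity subsolution of `λu + |Du|^p = w` in `Ω`
(with `C¹` test functions). -/
def ViscSubIn1 {n : ℕ} (Ω : Set (EuclideanSpace ℝ (Fin n))) (lam p : ℝ)
    (w u : EuclideanSpace ℝ (Fin n) → ℝ) : Prop :=
  ∀ x₀ ∈ Ω, ∀ φ : EuclideanSpace ℝ (Fin n) → ℝ, ContDiff ℝ 1 φ →
    IsLocalMaxOn (fun x => u x - φ x) Ω x₀ →
    lam * u x₀ + ‖gradient φ x₀‖ ^ p - w x₀ ≤ 0

/-- First-order (`ε = 0`) viscosity supersolution of `λv + |Dv|^p = w` on `closure Ω`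
(with `C¹` test functions). -/
def ViscSupOn1 {n : ℕ} (Ω : Set (EuclideanSpace ℝ (Fin n))) (lam p : ℝ)
    (w v : EuclideanSpace ℝ (Fin n) → ℝ) : Prop :=
  ∀ x₀ ∈ closure Ω, ∀ φ : EuclideanSpace ℝ (Fin n) → ℝ, ContDiff ℝ 1 φ →
    IsLocalMinOn (fun x => v x - φ x) (closure Ω) x₀ →
    0 ≤ lam * v x₀ + ‖gradient φ x₀‖ ^ p - w x₀

/-- Classical (`C²`) solution of `λu + |Du|^p − ε·Δu = w` in the open set `Ω`. -/
def ClassicalSolIn {n : ℕ} (Ω : Set (EuclideanSpace ℝ (Fin n))) (lam p ε : ℝ)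
    (w u : EuclideanSpace ℝ (Fin n) → ℝ) : Prop :=
  ContDiffOn ℝ 2 u Ω ∧
    ∀ x ∈ Ω, lam * u x + ‖gradient u x‖ ^ p - ε * lapl u x = w x

/-- The boundary condition `liminf_{Ω ∋ x → x₀} (u(x) − u(x₀))/|x − x₀|^α < 0` at every
boundary point `x₀`. -/
def BdryStrict {n : ℕ} (Ω : Set (EuclideanSpace ℝ (Fin n))) (α : ℝ)
    (u : EuclideanSpace ℝ (Fin n) → ℝ) : Prop :=
  ∀ x₀ ∈ frontier Ω,
    Filter.liminf (fun x => (u x - u x₀) / ‖x - x₀‖ ^ α) (𝓝[Ω] x₀) < 0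

/-- `g` is semiconcave (with linear modulus) on `s` with semiconcavity constant `K`. -/
def SemicOn {n : ℕ} (g : EuclideanSpace ℝ (Fin n) → ℝ)
    (s : Set (EuclideanSpace ℝ (Fin n))) (K : ℝ) : Prop :=
  ∀ x y : EuclideanSpace ℝ (Fin n), segment ℝ x y ⊆ s → ∀ t ∈ Icc (0:ℝ) 1,
    t * g x + (1 - t) * g y - g (t • x + (1 - t) • y) ≤ t * (1 - t) * (K * ‖x - y‖ ^ 2 / 2)

theorem aux_1d (F F1 : ℝ → ℝ) (D : ℝ) (hmax : IsLocalMax F 0)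
    (h1 : ∀ᶠ t in 𝓝 (0:ℝ), HasDerivAt F (F1 t) t) (h2 : HasDerivAt F1 D 0) :
    F1 0 = 0 ∧ D ≤ 0 := by
  have h0 : F1 0 = 0 := hmax.hasDerivAt_eq_zero h1.self_of_nhds
  refine ⟨h0, ?_⟩
  by_contra hD
  push Not at hD
  have hd : deriv F =ᶠ[𝓝 0] F1 := h1.mono fun t ht => ht.deriv
  have hdd : deriv (deriv F) 0 = D := by
    rw [hd.deriv_eq]; exact h2.deriv
  have hmin : IsLocalMin F 0 := isLocalMin_of_deriv_deriv_pos (by rw [hdd]; exact hD)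
    (by rw [hd.self_of_nhds]; exact h0) h1.self_of_nhds.continuousAt
  have hc : F =ᶠ[𝓝 0] fun _ => F 0 := by
    filter_upwards [hmax, hmin] with t a b using le_antisymm a b
  have hc1 : deriv F =ᶠ[𝓝 0] fun _ => 0 := by
    have := hc.deriv
    simpa using this
  have : deriv (deriv F) 0 = 0 := by
    rw [hc1.deriv_eq]; simp
  linarith

theorem aux_2nd {n : ℕ} (U : EuclideanSpace ℝ (Fin n) → ℝ) (x P N : EuclideanSpace ℝ (Fin n))
    (hU : ContDiffAt ℝ 2 U x) (Q k τ D : ℝ) (hN : D * ‖N‖ ^ 2 = D) (g g1 : ℝ → ℝ)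
    (hg : ∀ᶠ t in 𝓝 τ, HasDerivAt g (g1 t) t) (hg1 : HasDerivAt g1 D τ)
    (hmax : ∀ᶠ v in 𝓝 (0 : EuclideanSpace ℝ (Fin n)),
      U (x + v) ≤ U x + inner ℝ P v + Q / 2 * ‖v‖ ^ 2
        - (g (τ + inner ℝ N v - k / 2 * ‖v‖ ^ 2) - g τ)) :
    gradient U x = P - g1 τ • N ∧ lapl U x ≤ n * Q + n * k * g1 τ - D := by
  have hf1 : ContDiffAt ℝ 1 (fderiv ℝ U) x := hU.fderiv_right (by norm_num)
  have hd1 : HasFDerivAt (fderiv ℝ U) (fderiv ℝ (fderiv ℝ U) x) x :=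
    (hf1.differentiableAt (by norm_num)).hasFDerivAt
  have hUd : ∀ᶠ y in 𝓝 x, DifferentiableAt ℝ U y := by
    have := hU.eventually (by simp)
    exact this.mono fun y hy => hy.differentiableAt (by norm_num)
  have key : ∀ e : EuclideanSpace ℝ (Fin n),
      fderiv ℝ U x e - inner ℝ P e + g1 τ * inner ℝ N e = 0 ∧
      fderiv ℝ (fderiv ℝ U) x e e - Q * ‖e‖ ^ 2
        + (D * (inner ℝ N e) ^ 2 - g1 τ * (k * ‖e‖ ^ 2)) ≤ 0 := by
    intro e
    have hline : ∀ t : ℝ, HasDerivAt (fun t : ℝ => x + t • e) e t := by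
      intro t
      simpa using ((hasDerivAt_id t).smul_const e).const_add x
    have hq : ∀ t : ℝ, HasDerivAt (fun t : ℝ => τ + t * inner ℝ N e - k / 2 * (t ^ 2 * ‖e‖ ^ 2))
        (inner ℝ N e - k * (t * ‖e‖ ^ 2)) t := by
      intro t
      have h1 := ((hasDerivAt_id t).mul_const (inner ℝ N e)).const_add τ
      have h2 := (((hasDerivAt_id t).pow 2).mul_const (‖e‖ ^ 2)).const_mul (k / 2)
      refine (h1.sub h2).congr_deriv ?_
      simp; ring
    have hl0 : Tendsto (fun t : ℝ => x + t • e) (𝓝 0) (𝓝 x) := by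
      have := (hline 0).continuousAt.tendsto
      simpa using this
    have hq0 : Tendsto (fun t : ℝ => τ + t * inner ℝ N e - k / 2 * (t ^ 2 * ‖e‖ ^ 2))
        (𝓝 0) (𝓝 τ) := by
      have := (hq 0).continuousAt.tendsto
      simpa using this
    have hv0 : Tendsto (fun t : ℝ => t • e) (𝓝 0) (𝓝 0) := by
      have : Continuous (fun t : ℝ => t • e) := by fun_prop
      simpa using this.tendsto 0
    have res := aux_1d
      (fun t => U (x + t • e) - t * inner ℝ P e - Q / 2 * (t ^ 2 * ‖e‖ ^ 2)
        + g (τ + t * inner ℝ N e - k / 2 * (t ^ 2 * ‖e‖ ^ 2)))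
      (fun t => fderiv ℝ U (x + t • e) e - inner ℝ P e - Q * (t * ‖e‖ ^ 2)
        + g1 (τ + t * inner ℝ N e - k / 2 * (t ^ 2 * ‖e‖ ^ 2)) *
          (inner ℝ N e - k * (t * ‖e‖ ^ 2)))
      (fderiv ℝ (fderiv ℝ U) x e e - Q * ‖e‖ ^ 2
        + (D * (inner ℝ N e) ^ 2 - g1 τ * (k * ‖e‖ ^ 2))) ?_ ?_ ?_
    · refine ⟨?_, res.2⟩
      have := res.1
      simpa using this
    · filter_upwards [hv0.eventually hmax] with t ht
      simp only [norm_smul, inner_smul_right, mul_pow, Real.norm_eq_abs, sq_abs] at ht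
      simp
      linarith
    · filter_upwards [hl0.eventually hUd, hq0.eventually hg] with t h1 h2
      have a1 := h1.hasFDerivAt.comp_hasDerivAt t (hline t)
      have a2 := (hasDerivAt_id t).mul_const (inner ℝ P e)
      have a3 := (((hasDerivAt_id t).pow 2).mul_const (‖e‖ ^ 2)).const_mul (Q / 2)
      have a4 := h2.comp t (hq t)
      refine (((a1.sub a2).sub a3).add a4).congr_deriv ?_
      simp; ring
    · have hd1' : HasFDerivAt (fderiv ℝ U) (fderiv ℝ (fderiv ℝ U) x) (x + (0:ℝ) • e) := by
        simpa using hd1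
      have b1 := hd1'.comp_hasDerivAt (0:ℝ) (hline 0)
      have b1' := b1.clm_apply (hasDerivAt_const (0:ℝ) e)
      have b2 := ((hasDerivAt_id (0:ℝ)).mul_const (‖e‖ ^ 2)).const_mul Q
      have hg1' : HasDerivAt g1 D (τ + (0:ℝ) * inner ℝ N e - k / 2 * ((0:ℝ) ^ 2 * ‖e‖ ^ 2)) := by
        simpa using hg1
      have b3 := hg1'.comp (0:ℝ) (hq 0)
      have b4 := (((hasDerivAt_id (0:ℝ)).mul_const (‖e‖ ^ 2)).const_mul k).const_sub (inner ℝ N e)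
      refine (((b1'.sub_const (inner ℝ P e)).sub b2).add (b3.mul b4)).congr_deriv ?_
      simp; ring
  constructor
  · refine ext_inner_right ℝ fun e => ?_
    have h := (key e).1
    have h2 : inner ℝ (gradient U x) e = fderiv ℝ U x e := by
      simp [gradient]
    rw [h2, inner_sub_left, inner_smul_left]
    simp
    linarith
  · unfold lapl
    have hsum : D * ∑ i : Fin n, (N i) ^ 2 = D := by
      have := EuclideanSpace.norm_sq_eq N
      simp only [Real.norm_eq_abs, sq_abs] at this
      rw [← this]; exact hN
    have hle : ∀ i : Fin n, fderiv ℝ (fderiv ℝ U) x (EuclideanSpace.single i 1)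
        (EuclideanSpace.single i 1) ≤ Q + k * g1 τ - D * (N i) ^ 2 := by
      intro i
      have h := (key (EuclideanSpace.single i 1)).2
      simp [EuclideanSpace.inner_single_right] at h
      linarith
    calc _ ≤ ∑ i : Fin n, (Q + k * g1 τ - D * (N i) ^ 2) := Finset.sum_le_sum fun i _ => hle i
      _ = n * Q + n * k * g1 τ - D := by
        rw [Finset.sum_sub_distrib, ← Finset.mul_sum, hsum]
        simp; ring

theorem aux_nearest {n : ℕ} (Ω : Set (EuclideanSpace ℝ (Fin n))) (hne : (frontier Ω).Nonempty)
    (x : EuclideanSpace ℝ (Fin n)) : ∃ z ∈ frontier Ω, dBdry Ω x = ‖x - z‖ := by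
  obtain ⟨z, hz, h⟩ := isClosed_frontier.exists_infDist_eq_dist hne x
  exact ⟨z, hz, by rw [← dist_eq_norm]; exact h⟩

theorem aux_dlip {n : ℕ} (Ω : Set (EuclideanSpace ℝ (Fin n)))
    (x y : EuclideanSpace ℝ (Fin n)) : dBdry Ω x ≤ dBdry Ω y + ‖x - y‖ := by
  rw [← dist_eq_norm]
  exact Metric.infDist_le_infDist_add_dist

theorem aux_dcont {n : ℕ} (Ω : Set (EuclideanSpace ℝ (Fin n))) : Continuous (dBdry Ω) :=
  Metric.continuous_infDist_pt _

theorem aux_dnonneg {n : ℕ} (Ω : Set (EuclideanSpace ℝ (Fin n)))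
    (x : EuclideanSpace ℝ (Fin n)) : 0 ≤ dBdry Ω x := Metric.infDist_nonneg

theorem aux_toward {n : ℕ} (Ω : Set (EuclideanSpace ℝ (Fin n)))
    (x z : EuclideanSpace ℝ (Fin n)) (hz : z ∈ frontier Ω) (h : dBdry Ω x = ‖x - z‖)
    (t : ℝ) (ht1 : t ≤ 1) :
    dBdry Ω (x + t • (z - x)) ≤ (1 - t) * dBdry Ω x := by
  have h1 : dBdry Ω (x + t • (z - x)) ≤ dist (x + t • (z - x)) z := Metric.infDist_le_dist_of_mem hz
  have h2 : x + t • (z - x) - z = (1 - t) • (x - z) := by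
    rw [sub_smul, one_smul, smul_sub, smul_sub]; abel
  rw [dist_eq_norm, h2, norm_smul, Real.norm_of_nonneg (by linarith)] at h1
  rw [h]; exact h1

theorem aux_mem_of_pos {n : ℕ} (Ω : Set (EuclideanSpace ℝ (Fin n))) (hΩo : IsOpen Ω)
    (x : EuclideanSpace ℝ (Fin n)) (hx : x ∈ closure Ω) (hd : 0 < dBdry Ω x) : x ∈ Ω := by
  by_contra hn
  have : x ∈ frontier Ω := by
    rw [hΩo.frontier_eq]; exact ⟨hx, hn⟩
  have h0 : dBdry Ω x = 0 := Metric.infDist_zero_of_mem this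
  linarith

theorem aux_pos_of_mem {n : ℕ} (Ω : Set (EuclideanSpace ℝ (Fin n))) (hΩo : IsOpen Ω)
    (hne : (frontier Ω).Nonempty)
    (x : EuclideanSpace ℝ (Fin n)) (hx : x ∈ Ω) : 0 < dBdry Ω x := by
  refine (isClosed_frontier.notMem_iff_infDist_pos hne).1 ?_
  rw [hΩo.frontier_eq]; exact fun h => h.2 hx

/-- The gradient of the distance has norm at least one: no one-sided slope bound `< 1`. -/
theorem aux_slope {n : ℕ} (Ω : Set (EuclideanSpace ℝ (Fin n)))
    (hne : (frontier Ω).Nonempty)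
    (y : EuclideanSpace ℝ (Fin n)) (hd : 0 < dBdry Ω y) (hdiff : DifferentiableAt ℝ (dBdry Ω) y)
    (η : ℝ) (hη : η < 1)
    (hloc : ∀ᶠ v in 𝓝 (0 : EuclideanSpace ℝ (Fin n)), dBdry Ω (y + v) ≤ dBdry Ω y + η * ‖v‖) :
    False := by
  obtain ⟨z, hz, hyz⟩ := aux_nearest Ω hne y
  have hline : HasDerivAt (fun t : ℝ => y + t • (z - y)) (z - y) 0 := by
    simpa using ((hasDerivAt_id (0:ℝ)).smul_const (z - y)).const_add y
  have hdiff' : HasFDerivAt (dBdry Ω) (fderiv ℝ (dBdry Ω) y) (y + (0:ℝ) • (z - y)) := by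
    simpa using hdiff.hasFDerivAt
  have hder := hdiff'.comp_hasDerivAt (0:ℝ) hline
  -- F(t) = d(y+t(z-y)) + t d(y) ≤ d(y) for t ≤ 1, so local max at 0
  have hmax : IsLocalMax (fun t : ℝ => dBdry Ω (y + t • (z - y)) + t * dBdry Ω y) 0 := by
    have : ∀ᶠ t in 𝓝 (0:ℝ), t < 1 := eventually_lt_nhds (by norm_num)
    filter_upwards [this] with t ht
    have := aux_toward Ω y z hz hyz t ht.le
    simp
    linarith
  have hz0 := hmax.hasDerivAt_eq_zero (hder.add ((hasDerivAt_id (0:ℝ)).mul_const (dBdry Ω y)))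
  have hval : fderiv ℝ (dBdry Ω) y (z - y) = - dBdry Ω y := by
    simp at hz0; simp; linarith
  -- t ↦ d(y - t(z-y)) - η t d(y)
  have hv0 : Tendsto (fun t : ℝ => t • (y - z)) (𝓝[>] 0) (𝓝 0) := by
    have : Continuous (fun t : ℝ => t • (y - z)) := by fun_prop
    have h := this.tendsto 0
    simp only [zero_smul] at h
    exact h.mono_left nhdsWithin_le_nhds
  have hline2 : HasDerivAt (fun t : ℝ => y + t • (y - z)) (y - z) 0 := by
    simpa using ((hasDerivAt_id (0:ℝ)).smul_const (y - z)).const_add y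
  have hdiff2 : HasFDerivAt (dBdry Ω) (fderiv ℝ (dBdry Ω) y) (y + (0:ℝ) • (y - z)) := by
    simpa using hdiff.hasFDerivAt
  have hder2 := hdiff2.comp_hasDerivAt (0:ℝ) hline2
  have hval2 : fderiv ℝ (dBdry Ω) y (y - z) = dBdry Ω y := by
    rw [← neg_sub z y, map_neg, hval]; ring
  rw [hval2] at hder2
  have hs := hder2.tendsto_slope
  have hsub : (𝓝[>] (0:ℝ)) ≤ 𝓝[≠] 0 := nhdsWithin_mono 0 (fun t ht => ne_of_gt ht)
  have hs' := hs.mono_left hsub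
  have hle : dBdry Ω y ≤ η * dBdry Ω y := by
    refine le_of_tendsto hs' ?_
    filter_upwards [hv0.eventually hloc, self_mem_nhdsWithin] with t h1 h2
    have ht : 0 < t := h2
    rw [norm_smul, Real.norm_of_nonneg ht.le, ← hyz] at h1
    simp only [slope, Function.comp, vsub_eq_sub, smul_eq_mul, zero_smul, add_zero, sub_zero]
    rw [inv_mul_le_iff₀ ht]
    linarith
  nlinarith

theorem aux_center {n : ℕ} (Ω : Set (EuclideanSpace ℝ (Fin n))) (hΩo : IsOpen Ω)
    (hne : (frontier Ω).Nonempty) (δ : ℝ)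
    (hC : ContDiffOn ℝ 2 (dBdry Ω) {x ∈ Ω | dBdry Ω x ≤ δ})
    (x : EuclideanSpace ℝ (Fin n)) (hx : x ∈ Ω) (s : ℝ) (hs : 0 < s)
    (hxs : dBdry Ω x + s < δ) :
    ∃ y, ‖y - x‖ = s ∧ dBdry Ω y = dBdry Ω x + s := by
  have hdx := aux_pos_of_mem Ω hΩo hne x hx
  set K : Set (EuclideanSpace ℝ (Fin n)) := closedBall x s ∩ closure Ω with hK
  have hKc : IsCompact K := (isCompact_closedBall x s).inter_right isClosed_closure
  have hKn : K.Nonempty := ⟨x, mem_closedBall_self hs.le, subset_closure hx⟩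
  have step : ∀ η : ℝ, 0 < η → η < 1 → ∃ y ∈ K, dBdry Ω x + η * s ≤ dBdry Ω y := by
    intro η hη0 hη
    obtain ⟨y, hyK, hymax⟩ := hKc.exists_isMaxOn hKn
      (f := fun y => dBdry Ω y - η * ‖y - x‖)
      (((aux_dcont Ω).sub (continuous_const.mul (by fun_prop))).continuousOn)
    have h1 : dBdry Ω x ≤ dBdry Ω y - η * ‖y - x‖ := by
      have := hymax ⟨mem_closedBall_self hs.le, subset_closure hx⟩
      simpa using this
    have hys : ‖y - x‖ ≤ s := by
      have := hyK.1
      rwa [mem_closedBall, dist_eq_norm] at this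
    have hyd : 0 < dBdry Ω y := by
      have : 0 ≤ η * ‖y - x‖ := by positivity
      linarith
    have hyΩ := aux_mem_of_pos Ω hΩo y hyK.2 hyd
    rcases hys.eq_or_lt with he | hlt
    · refine ⟨y, hyK, ?_⟩
      rw [he] at h1; linarith
    · exfalso
      have hdlt : dBdry Ω y < δ := by
        have := aux_dlip Ω y x
        linarith
      have hnb : {x ∈ Ω | dBdry Ω x ≤ δ} ∈ 𝓝 y := by
        filter_upwards [hΩo.mem_nhds hyΩ,
          (aux_dcont Ω).continuousAt.eventually (eventually_lt_nhds hdlt)] with w h1 h2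
        exact ⟨h1, h2.le⟩
      have hdiff : DifferentiableAt ℝ (dBdry Ω) y :=
        (hC.contDiffAt hnb).differentiableAt (by norm_num)
      refine aux_slope Ω hne y hyd hdiff η hη ?_
      have hK' : K ∈ 𝓝 y := by
        filter_upwards [hΩo.mem_nhds hyΩ,
          isOpen_ball.mem_nhds (show y ∈ ball x s by rwa [mem_ball, dist_eq_norm])] with w h1 h2
        exact ⟨ball_subset_closedBall h2, subset_closure h1⟩
      have ht : Tendsto (fun v : EuclideanSpace ℝ (Fin n) => y + v) (𝓝 0) (𝓝 y) := by
        have : Continuous (fun v : EuclideanSpace ℝ (Fin n) => y + v) := by fun_prop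
        simpa using this.tendsto 0
      filter_upwards [ht.eventually hK'] with v hv
      have h2 := hymax hv
      simp only [mem_ofPred_eq] at h2
      have h3 : ‖y + v - x‖ ≤ ‖y - x‖ + ‖v‖ := by
        have : y + v - x = (y - x) + v := by abel
        rw [this]; exact norm_add_le _ _
      nlinarith
  obtain ⟨y, hyK, hymax⟩ := hKc.exists_isMaxOn hKn (f := dBdry Ω) (aux_dcont Ω).continuousOn
  have hys : ‖y - x‖ ≤ s := by
    have := hyK.1
    rwa [mem_closedBall, dist_eq_norm] at this
  have hge : dBdry Ω x + s ≤ dBdry Ω y := by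
    by_contra hcon
    push Not at hcon
    have hyx : dBdry Ω x ≤ dBdry Ω y :=
      hymax ⟨mem_closedBall_self hs.le, subset_closure hx⟩
    -- choose η between
    set q := (dBdry Ω y - dBdry Ω x) / s with hq
    have hq1 : q < 1 := by rw [hq, div_lt_one hs]; linarith
    have hq0 : 0 ≤ q := div_nonneg (by linarith) hs.le
    obtain ⟨w, hwK, hw⟩ := step ((q + 1) / 2) (by linarith) (by linarith)
    have h2 : dBdry Ω w ≤ dBdry Ω y := hymax hwK
    have h3 : q * s = dBdry Ω y - dBdry Ω x := by rw [hq]; field_simp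
    nlinarith
  have hle := aux_dlip Ω y x
  exact ⟨y, le_antisymm hys (by linarith), le_antisymm (by linarith) hge⟩

/-- Smooth penalization with bounded slope. -/
def thP {n : ℕ} (a b : ℝ) (z : EuclideanSpace ℝ (Fin n)) : ℝ :=
  b * (Real.sqrt (a ^ 2 + ‖z‖ ^ 2) - a)

/-- Gradient of `thP`. -/
def pgP {n : ℕ} (a b : ℝ) (z : EuclideanSpace ℝ (Fin n)) : EuclideanSpace ℝ (Fin n) :=
  (b / Real.sqrt (a ^ 2 + ‖z‖ ^ 2)) • z

theorem aux_sqrt_le {A X : ℝ} (hA : 0 < A) (hX : 0 ≤ A ^ 2 + X) :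
    Real.sqrt (A ^ 2 + X) ≤ A + X / (2 * A) := by
  have h : A + X / (2 * A) = (2 * A ^ 2 + X) / (2 * A) := by field_simp
  apply Real.sqrt_le_iff.2
  constructor
  · rw [h]; apply div_nonneg <;> nlinarith [sq_nonneg A]
  · have : (A + X / (2 * A)) ^ 2 = A ^ 2 + X + (X / (2 * A)) ^ 2 := by field_simp; ring
    rw [this]; nlinarith [sq_nonneg (X / (2 * A))]

section pen
variable {n : ℕ}

theorem thP_w (a : ℝ) (ha : 0 < a) (z : EuclideanSpace ℝ (Fin n)) :
    a ≤ Real.sqrt (a ^ 2 + ‖z‖ ^ 2) := by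
  apply Real.le_sqrt_of_sq_le; nlinarith [sq_nonneg ‖z‖]

theorem thP_nonneg (a b : ℝ) (ha : 0 < a) (hb : 0 < b) (z : EuclideanSpace ℝ (Fin n)) :
    0 ≤ thP a b z := by
  have := thP_w a ha z
  exact mul_nonneg hb.le (by linarith)

theorem thP_zero (a b : ℝ) (ha : 0 < a) : thP a b (0 : EuclideanSpace ℝ (Fin n)) = 0 := by
  simp [thP, Real.sqrt_sq ha.le]

theorem thP_neg (a b : ℝ) (z : EuclideanSpace ℝ (Fin n)) : thP a b (-z) = thP a b z := by
  simp [thP]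

theorem thP_cont (a b : ℝ) : Continuous (thP a b : EuclideanSpace ℝ (Fin n) → ℝ) := by
  unfold thP; fun_prop

theorem thP_quad (a b : ℝ) (ha : 0 < a) (hb : 0 < b) (z v : EuclideanSpace ℝ (Fin n)) :
    thP a b (z + v) ≤ thP a b z + inner ℝ (pgP a b z) v + (b / a) / 2 * ‖v‖ ^ 2 := by
  set w := Real.sqrt (a ^ 2 + ‖z‖ ^ 2) with hw
  have hwa : a ≤ w := thP_w a ha z
  have hw0 : 0 < w := by linarith
  have hw2 : w ^ 2 = a ^ 2 + ‖z‖ ^ 2 := Real.sq_sqrt (by positivity)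
  have he : a ^ 2 + ‖z + v‖ ^ 2 = w ^ 2 + (2 * inner ℝ z v + ‖v‖ ^ 2) := by
    rw [norm_add_sq_real, hw2]; ring
  have h1 := aux_sqrt_le hw0 (X := 2 * inner ℝ z v + ‖v‖ ^ 2) (by rw [← he]; positivity)
  unfold thP pgP
  rw [he, inner_smul_left, ← hw]
  simp only [conj_trivial]
  have h2 : ‖v‖ ^ 2 / (2 * w) ≤ ‖v‖ ^ 2 / (2 * a) := by gcongr
  have h3 : (2 * inner ℝ z v + ‖v‖ ^ 2) / (2 * w) = inner ℝ z v / w + ‖v‖ ^ 2 / (2 * w) := by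
    field_simp
  have h4 : Real.sqrt (w ^ 2 + (2 * inner ℝ z v + ‖v‖ ^ 2)) ≤
      w + inner ℝ z v / w + ‖v‖ ^ 2 / (2 * a) := by linarith
  have h5 := mul_le_mul_of_nonneg_left h4 hb.le
  have h6 : b * (w + inner ℝ z v / w + ‖v‖ ^ 2 / (2 * a)) =
    b * w + b / w * inner ℝ z v + b / a / 2 * ‖v‖ ^ 2 := by field_simp
  linarith

theorem pgP_norm (a b : ℝ) (ha : 0 < a) (hb : 0 < b) (z : EuclideanSpace ℝ (Fin n)) :
    ‖pgP a b z‖ = b * ‖z‖ / Real.sqrt (a ^ 2 + ‖z‖ ^ 2) := by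
  have hwa := thP_w a ha z
  unfold pgP
  rw [norm_smul, Real.norm_of_nonneg (by positivity)]; ring

theorem pgP_sq (a b : ℝ) (ha : 0 < a) (hb : 0 < b) (z : EuclideanSpace ℝ (Fin n)) :
    ‖pgP a b z‖ ^ 2 ≤ 2 * (b / a) * thP a b z := by
  rw [pgP_norm a b ha hb]
  unfold thP
  set w := Real.sqrt (a ^ 2 + ‖z‖ ^ 2) with hw
  have hwa : a ≤ w := thP_w a ha z
  have hw0 : 0 < w := by linarith
  have hw2 : w ^ 2 = a ^ 2 + ‖z‖ ^ 2 := Real.sq_sqrt (by positivity)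
  have h1 : (b * ‖z‖ / w) ^ 2 = b ^ 2 * ((w - a) * (w + a)) / w ^ 2 := by
    rw [div_pow, mul_pow]; congr 2; linarith
  rw [h1, div_le_iff₀ (by positivity)]
  have h2 : 2 * (b / a) * (b * (w - a)) * w ^ 2 = b ^ 2 * ((w - a) * (2 * w ^ 2 / a)) := by
    field_simp
  rw [h2]
  have h3 : w + a ≤ 2 * w ^ 2 / a := by
    rw [le_div_iff₀ ha]; nlinarith
  have : 0 ≤ w - a := by linarith
  gcongr

theorem pgP_small (a b M : ℝ) (ha : 0 < a) (hM : 0 ≤ M) (hb : b = 2 * M + 1)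
    (z : EuclideanSpace ℝ (Fin n)) (h : ‖pgP a b z‖ ≤ M) : ‖z‖ ≤ 2 * (a / b) * M := by
  have hb0 : 0 < b := by linarith
  rw [pgP_norm a b ha hb0] at h
  set w := Real.sqrt (a ^ 2 + ‖z‖ ^ 2) with hw
  have hwa : a ≤ w := thP_w a ha z
  have hw0 : 0 < w := by linarith
  have hw2 : w ^ 2 = a ^ 2 + ‖z‖ ^ 2 := Real.sq_sqrt (by positivity)
  rw [div_le_iff₀ hw0] at h
  have hz : 2 * ‖z‖ ≤ w := by
    by_contra hc
    push Not at hc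
    nlinarith [norm_nonneg z]
  have hw3 : w ≤ 2 * a := by
    have := norm_nonneg z
    nlinarith
  have : 2 * (a / b) * M = 2 * a * M / b := by ring
  rw [this, le_div_iff₀ hb0]
  nlinarith

theorem thP_contDiff (a b : ℝ) (ha : 0 < a) :
    ContDiff ℝ 1 (thP a b : EuclideanSpace ℝ (Fin n) → ℝ) := by
  unfold thP
  refine contDiff_const.mul (ContDiff.sub (ContDiff.sqrt ?_ ?_) contDiff_const)
  · exact contDiff_const.add (contDiff_id.norm_sq ℝ)
  · intro x; positivity

theorem thP_grad (a b : ℝ) (ha : 0 < a) (hb : 0 < b) (x y : EuclideanSpace ℝ (Fin n)) :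
    gradient (fun y => - thP a b (x - y)) y = pgP a b (x - y) := by
  have hcd : ContDiff ℝ 1 (fun y => - thP a b (x - y)) :=
    ((thP_contDiff a b ha).comp (contDiff_const.sub contDiff_id)).neg
  have hd : DifferentiableAt ℝ (fun y => - thP a b (x - y)) y :=
    hcd.differentiable (by norm_num) y
  refine ext_inner_right ℝ fun e => ?_
  rw [inner_gradient_left]
  have hline : HasDerivAt (fun t : ℝ => y + t • e) e 0 := by
    simpa using ((hasDerivAt_id (0:ℝ)).smul_const e).const_add y
  have hd' : HasFDerivAt (fun y => - thP a b (x - y))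
      (fderiv ℝ (fun y => - thP a b (x - y)) y) (y + (0:ℝ) • e) := by
    simpa using hd.hasFDerivAt
  have h1 := hd'.comp_hasDerivAt (0:ℝ) hline
  have h2 := (hasDerivAt_id (0:ℝ)).mul_const (inner ℝ (pgP a b (x - y)) e)
  have h3 := (((hasDerivAt_id (0:ℝ)).pow 2).const_mul ((b / a) / 2 * ‖e‖ ^ 2))
  have hmin : IsLocalMin (fun t : ℝ => - thP a b (x - (y + t • e))
      - t * inner ℝ (pgP a b (x - y)) e + (b / a) / 2 * ‖e‖ ^ 2 * t ^ 2) 0 := by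
    refine Filter.Eventually.of_forall fun t => ?_
    have := thP_quad a b ha hb (x - y) (-(t • e))
    rw [inner_neg_right, inner_smul_right, norm_neg, norm_smul, mul_pow, Real.norm_eq_abs,
      sq_abs] at this
    have he : x - y + -(t • e) = x - (y + t • e) := by abel
    rw [he] at this
    simp only [zero_smul, add_zero]
    nlinarith
  have h4 := hmin.hasDerivAt_eq_zero ((h1.sub h2).add h3)
  simp at h4
  simp
  linarith

end pen

theorem aux_f_le {n : ℕ} (Ω : Set (EuclideanSpace ℝ (Fin n)))
    (hne : (frontier Ω).Nonempty) (f : EuclideanSpace ℝ (Fin n) → ℝ) (Lf : ℝ≥0)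
    (hfLip : LipschitzOnWith Lf f (closure Ω)) (hf_bdry : ∀ x ∈ frontier Ω, f x = 0)
    (x : EuclideanSpace ℝ (Fin n)) (hx : x ∈ closure Ω) : f x ≤ Lf * dBdry Ω x := by
  obtain ⟨z, hz, h⟩ := aux_nearest Ω hne x
  have h1 := hfLip.dist_le_mul x hx z (frontier_subset_closure hz)
  rw [hf_bdry z hz, dist_eq_norm, dist_eq_norm, ← h] at h1
  simp at h1
  exact (le_abs_self _).trans h1

/-- Explicit supersolution vanishing superlinearly at the boundary. -/
def SP {n : ℕ} (Ω : Set (EuclideanSpace ℝ (Fin n))) (L p : ℝ) (y : EuclideanSpace ℝ (Fin n)) : ℝ :=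
  dBdry Ω y * (L * dBdry Ω y) ^ (1 / p)

theorem aux_Y {n : ℕ} (Ω : Set (EuclideanSpace ℝ (Fin n))) (hΩo : IsOpen Ω)
    (hne : (frontier Ω).Nonempty) (p lam : ℝ) (hp : 2 < p) (hlam : 0 < lam)
    (f : EuclideanSpace ℝ (Fin n) → ℝ) (Lf : ℝ≥0)
    (hfLip : LipschitzOnWith Lf f (closure Ω)) (hf_bdry : ∀ x ∈ frontier Ω, f x = 0)
    (u : EuclideanSpace ℝ (Fin n) → ℝ) (hu0 : ∀ x ∈ closure Ω, 0 ≤ u x)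
    (hu_sup : ViscSupOn1 Ω lam p f u) (a b : ℝ) (ha : 0 < a) (hb : 0 < b)
    (x y : EuclideanSpace ℝ (Fin n)) (hy : y ∈ closure Ω)
    (hmin : ∀ w ∈ closure Ω, min (u y) (SP Ω Lf p y) + thP a b (x - y) ≤
      min (u w) (SP Ω Lf p w) + thP a b (x - w)) :
    f y ≤ lam * min (u y) (SP Ω Lf p y) + ‖pgP a b (x - y)‖ ^ p := by
  have hd := aux_dnonneg Ω y
  have hSn : 0 ≤ SP Ω Lf p y := by unfold SP; positivity
  rcases le_or_gt (u y) (SP Ω Lf p y) with hle | hlt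
  · rw [min_eq_left hle] at hmin ⊢
    have h := hu_sup y hy (fun w => - thP a b (x - w))
      (((thP_contDiff a b ha).comp (contDiff_const.sub contDiff_id)).neg) (by
        filter_upwards [self_mem_nhdsWithin] with w hw
        have := hmin w hw
        have := min_le_left (u w) (SP Ω Lf p w)
        linarith)
    rw [thP_grad a b ha hb] at h
    linarith
  · rw [min_eq_right hlt.le] at hmin ⊢
    have hfy := aux_f_le Ω hne f Lf hfLip hf_bdry y hy
    rcases hd.eq_or_lt with h0 | hpos
    · rw [← h0] at hfy
      have : 0 ≤ ‖pgP a b (x - y)‖ ^ p := by positivity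
      have := mul_nonneg hlam.le hSn
      linarith
    · have hyΩ := aux_mem_of_pos Ω hΩo y hy hpos
      obtain ⟨z, hz, hyz⟩ := aux_nearest Ω hne y
      set P := pgP a b (x - y) with hP
      have hlim : SP Ω Lf p y ≤ inner ℝ P (y - z) := by
        have ht0 : Tendsto (fun t : ℝ => inner ℝ P (y - z) + t * ((b / a) / 2 * ‖y - z‖ ^ 2))
            (𝓝[>] 0) (𝓝 (inner ℝ P (y - z))) := by
          have : Continuous (fun t : ℝ => inner ℝ P (y - z) + t * ((b / a) / 2 * ‖y - z‖ ^ 2)) := by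
            fun_prop
          have h := this.tendsto 0
          simp only [zero_mul, add_zero] at h
          exact h.mono_left nhdsWithin_le_nhds
        refine ge_of_tendsto ht0 ?_
        have hv0 : Tendsto (fun t : ℝ => y + t • (z - y)) (𝓝[>] 0) (𝓝 y) := by
          have : Continuous (fun t : ℝ => y + t • (z - y)) := by fun_prop
          have h := this.tendsto 0
          simp only [zero_smul, add_zero] at h
          exact h.mono_left nhdsWithin_le_nhds
        have h1 : ∀ᶠ t in 𝓝[>] (0:ℝ), t < 1 :=
          (eventually_lt_nhds (by norm_num)).filter_mono nhdsWithin_le_nhds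
        filter_upwards [hv0.eventually (hΩo.mem_nhds hyΩ), h1, self_mem_nhdsWithin] with t ht ht1 ht2
        have ht2' : 0 < t := ht2
        have hm := hmin _ (subset_closure ht)
        have hm2 := min_le_right (u (y + t • (z - y))) (SP Ω Lf p (y + t • (z - y)))
        have hS : SP Ω Lf p (y + t • (z - y)) ≤ (1 - t) * SP Ω Lf p y := by
          have hdt := aux_toward Ω y z hz hyz t ht1.le
          have hdt0 := aux_dnonneg Ω (y + t • (z - y))
          have hdt1 : dBdry Ω (y + t • (z - y)) ≤ dBdry Ω y := by nlinarith
          unfold SP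
          rw [← mul_assoc]
          have : ((Lf:ℝ) * dBdry Ω (y + t • (z - y))) ^ (1 / p) ≤ ((Lf:ℝ) * dBdry Ω y) ^ (1 / p) := by
            apply Real.rpow_le_rpow (by positivity)
            · gcongr
            · positivity
          have h1t : 0 ≤ (1 - t) * dBdry Ω y := hdt0.trans hdt
          exact mul_le_mul hdt this (by positivity) h1t
        have hq := thP_quad a b ha hb (x - y) (t • (y - z))
        have he : x - y + t • (y - z) = x - (y + t • (z - y)) := by
          rw [smul_sub, smul_sub]; abel
        rw [he, inner_smul_right, norm_smul, Real.norm_of_nonneg ht2'.le, ← hP, mul_pow] at hq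
        have hfin : t * SP Ω Lf p y ≤
            t * (inner ℝ P (y - z) + t * ((b / a) / 2 * ‖y - z‖ ^ 2)) := by nlinarith
        exact le_of_mul_le_mul_left hfin ht2'
      have h2 : inner ℝ P (y - z) ≤ ‖P‖ * dBdry Ω y := by
        rw [hyz]; exact real_inner_le_norm _ _
      have h3 : ((Lf:ℝ) * dBdry Ω y) ^ (1 / p) ≤ ‖P‖ := by
        unfold SP at hlim
        have : dBdry Ω y * ((Lf:ℝ) * dBdry Ω y) ^ (1 / p) ≤ dBdry Ω y * ‖P‖ := by linarith
        exact le_of_mul_le_mul_left this hpos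
      have h4 : (((Lf:ℝ) * dBdry Ω y) ^ (1 / p)) ^ p ≤ ‖P‖ ^ p :=
        Real.rpow_le_rpow (by positivity) h3 (by linarith)
      rw [← Real.rpow_mul (by positivity), one_div, inv_mul_cancel₀ (by linarith),
        Real.rpow_one] at h4
      have := mul_nonneg hlam.le hSn
      linarith

/-- One-dimensional boundary profile. -/
def gP (B r β α t : ℝ) : ℝ := B * (r ^ β * t ^ α / α - t)

theorem gP_deriv (B r β α : ℝ) (hα : 0 < α) (t : ℝ) (ht : 0 < t) :
    HasDerivAt (gP B r β α) (B * (r ^ β * t ^ (α - 1) - 1)) t := by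
  have h := Real.hasDerivAt_rpow_const (p := α) (Or.inl ht.ne')
  have h2 := (((h.const_mul (r ^ β)).div_const α).sub (hasDerivAt_id t)).const_mul B
  refine h2.congr_deriv ?_
  field_simp

theorem gP_deriv2 (B r β α : ℝ) (t : ℝ) (ht : 0 < t) :
    HasDerivAt (fun t => B * (r ^ β * t ^ (α - 1) - 1))
      (B * (r ^ β * ((α - 1) * t ^ (α - 1 - 1)))) t := by
  have h := Real.hasDerivAt_rpow_const (p := α - 1) (Or.inl ht.ne')
  exact ((h.const_mul (r ^ β)).sub_const 1).const_mul B

theorem gP_cont (B r β α : ℝ) (hα : 0 < α) : Continuous (gP B r β α) := by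
  unfold gP
  have : Continuous (fun t : ℝ => t ^ α) := Real.continuous_rpow_const hα.le
  fun_prop

theorem gP_X {r β α t : ℝ} (hr : 0 < r) (ht : 0 < t) (hβ : 0 < β) (hαβ : α = 1 - β)
    (h : t ≤ r) : 1 ≤ r ^ β * t ^ (α - 1) := by
  have : α - 1 = -β := by rw [hαβ]; ring
  rw [this, Real.rpow_neg ht.le, ← div_eq_mul_inv, one_le_div (by positivity)]
  exact Real.rpow_le_rpow ht.le h hβ.le

theorem gP_mono (B r β α : ℝ) (hB : 0 < B) (hr : 0 < r) (hβ : 0 < β) (hα : 0 < α)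
    (hαβ : α = 1 - β) : MonotoneOn (gP B r β α) (Icc 0 r) := by
  refine monotoneOn_of_deriv_nonneg (convex_Icc 0 r) (gP_cont B r β α hα).continuousOn ?_ ?_
  · intro t ht
    rw [interior_Icc] at ht
    exact (gP_deriv B r β α hα t ht.1).differentiableAt.differentiableWithinAt
  · intro t ht
    rw [interior_Icc] at ht
    rw [(gP_deriv B r β α hα t ht.1).deriv]
    have := gP_X hr ht.1 hβ hαβ ht.2.le
    exact mul_nonneg hB.le (by linarith)

theorem gP_anti (B r β α : ℝ) (hB : 0 < B) (hr : 0 < r) (hβ : 0 < β) (hα : 0 < α)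
    (hαβ : α = 1 - β) : AntitoneOn (gP B r β α) (Ici r) := by
  refine antitoneOn_of_deriv_nonpos (convex_Ici r) (gP_cont B r β α hα).continuousOn ?_ ?_
  · intro t ht
    rw [interior_Ici] at ht
    exact (gP_deriv B r β α hα t (hr.trans ht)).differentiableAt.differentiableWithinAt
  · intro t ht
    rw [interior_Ici] at ht
    have ht0 : 0 < t := hr.trans ht
    rw [(gP_deriv B r β α hα t ht0).deriv]
    have : r ^ β * t ^ (α - 1) ≤ 1 := by
      have : α - 1 = -β := by rw [hαβ]; ring
      rw [this, Real.rpow_neg ht0.le, ← div_eq_mul_inv, div_le_one (by positivity)]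
      exact Real.rpow_le_rpow hr.le (le_of_lt ht) hβ.le
    exact mul_nonpos_of_nonneg_of_nonpos hB.le (by linarith)

/-- Truncated profile. -/
def GP (B r β α t : ℝ) : ℝ := gP B r β α (min t r)

theorem GP_mono (B r β α : ℝ) (hB : 0 < B) (hr : 0 < r) (hβ : 0 < β) (hα : 0 < α)
    (hαβ : α = 1 - β) (s t : ℝ) (hs : 0 ≤ s) (hst : s ≤ t) : GP B r β α s ≤ GP B r β α t := by
  refine gP_mono B r β α hB hr hβ hα hαβ ⟨le_min hs hr.le, min_le_right _ _⟩
    ⟨le_min (hs.trans hst) hr.le, min_le_right _ _⟩ (min_le_min_right _ hst)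

theorem gP_le_GP (B r β α : ℝ) (hB : 0 < B) (hr : 0 < r) (hβ : 0 < β) (hα : 0 < α)
    (hαβ : α = 1 - β) (t : ℝ) : gP B r β α t ≤ GP B r β α t := by
  unfold GP
  rcases le_total t r with h | h
  · rw [min_eq_left h]
  · rw [min_eq_right h]
    exact gP_anti B r β α hB hr hβ hα hαβ (mem_Ici.2 le_rfl) h h

theorem gP_zero (B r β α : ℝ) (hα : 0 < α) : gP B r β α 0 = 0 := by
  simp [gP, Real.zero_rpow hα.ne']

theorem GP_zero (B r β α : ℝ) (hr : 0 < r) (hα : 0 < α) : GP B r β α 0 = 0 := by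
  unfold GP; rw [min_eq_left hr.le, gP_zero B r β α hα]

theorem GP_le (B r β α : ℝ) (hB : 0 < B) (hr : 0 < r) (hβ : 0 < β) (hα : 0 < α)
    (hαβ : α = 1 - β) (t : ℝ) (ht : 0 ≤ t) : GP B r β α t ≤ B * r / α := by
  have h : GP B r β α t ≤ gP B r β α r :=
    gP_mono B r β α hB hr hβ hα hαβ ⟨le_min ht hr.le, min_le_right _ _⟩ ⟨hr.le, le_rfl⟩
      (min_le_right _ _)
  refine h.trans ?_
  unfold gP
  rw [← Real.rpow_add hr, hαβ]
  have : β + (1 - β) = 1 := by ring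
  rw [this, Real.rpow_one, ← hαβ, mul_div_assoc]
  nlinarith

theorem aux_bracket {n : ℕ} (p β ρ B e c X : ℝ) (P N : EuclideanSpace ℝ (Fin n))
    (hp : 2 < p) (hβ : 0 < β) (hρ : 0 < ρ) (hB : 0 < B) (he : 0 < e) (hc : 0 ≤ c) (hX : 1 ≤ X)
    (hP : ‖P‖ ≤ B) (hN : ‖N‖ = 1)
    (hE3 : e * (β / ρ) * B + e ^ 2 * c * B ≤ (B / 2) ^ p)
    (hE4 : e ^ 2 * c * (4 * B) ≤ e / 8) (hBs : (β / ρ) * B * 4 ^ p ≤ 1 / 8) :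
    e * (β / ρ) * B * X ^ p + e ^ 2 * c * (B * (X - 1)) ≤
      ‖P - (B * (X - 1)) • N‖ ^ p + e / 4 := by
  have hX0 : 0 < X := by linarith
  have hXp : X ≤ X ^ p := by
    conv_lhs => rw [← Real.rpow_one X]
    exact Real.rpow_le_rpow_of_exponent_le hX (by linarith)
  have hβρ : 0 < β / ρ := by positivity
  rcases le_or_gt 4 X with h4 | h4
  · have h1 : B * (X - 1) - B ≤ ‖P - (B * (X - 1)) • N‖ := by
      have := norm_sub_norm_le ((B * (X - 1)) • N) P
      rw [norm_smul, hN, Real.norm_of_nonneg (by nlinarith), norm_sub_rev] at this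
      linarith
    have h2 : B / 2 * X ≤ ‖P - (B * (X - 1)) • N‖ := by nlinarith
    have h3 : (B / 2 * X) ^ p ≤ ‖P - (B * (X - 1)) • N‖ ^ p :=
      Real.rpow_le_rpow (by positivity) h2 (by linarith)
    rw [Real.mul_rpow (by positivity) hX0.le] at h3
    have h5 : e ^ 2 * c * (B * (X - 1)) ≤ e ^ 2 * c * B * X ^ p := by
      have : e ^ 2 * c * (B * (X - 1)) = e ^ 2 * c * B * (X - 1) := by ring
      rw [this]; gcongr; linarith
    have h6 := mul_le_mul_of_nonneg_right hE3 (by positivity : 0 ≤ X ^ p)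
    nlinarith
  · have h1 : X ^ p ≤ 4 ^ p := Real.rpow_le_rpow hX0.le h4.le (by linarith)
    have h2 : e * (β / ρ) * B * X ^ p ≤ e * (1 / 8) := by
      calc e * (β / ρ) * B * X ^ p ≤ e * (β / ρ) * B * 4 ^ p := by gcongr
        _ = e * ((β / ρ) * B * 4 ^ p) := by ring
        _ ≤ _ := by gcongr
    have h3 : e ^ 2 * c * (B * (X - 1)) ≤ e ^ 2 * c * (4 * B) := by
      apply mul_le_mul_of_nonneg_left _ (by positivity); nlinarith
    have : 0 ≤ ‖P - (B * (X - 1)) • N‖ ^ p := by positivity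
    linarith

theorem aux_D (p β α r τ B : ℝ) (hp : 2 < p) (hβ : β = 1 / (p - 1)) (hαβ : α = 1 - β)
    (hr : 0 < r) (hτ : 0 < τ) :
    -(B * (r ^ β * ((α - 1) * τ ^ (α - 1 - 1)))) = β / r * B * (r ^ β * τ ^ (α - 1)) ^ p := by
  have hp1 : 0 < p - 1 := by linarith
  have h1 : α - 1 = -β := by rw [hαβ]; ring
  have hX : 0 < r ^ β * τ ^ (α - 1) := by positivity
  have h2 : (r ^ β * τ ^ (α - 1)) ^ p = (r ^ β * τ ^ (α - 1)) * (r / τ) := by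
    have : p = 1 + (p - 1) := by ring
    conv_lhs => rw [this]
    rw [Real.rpow_add hX, Real.rpow_one, Real.mul_rpow (by positivity) (by positivity),
      ← Real.rpow_mul hr.le, ← Real.rpow_mul hτ.le, h1]
    have e1 : β * (p - 1) = 1 := by rw [hβ]; field_simp
    have e2 : -β * (p - 1) = -1 := by linarith
    rw [e1, e2, Real.rpow_one, Real.rpow_neg_one]; rfl
  rw [h2, Real.rpow_sub_one hτ.ne', h1]
  field_simp

theorem aux_edge {n : ℕ} (Ω : Set (EuclideanSpace ℝ (Fin n))) (hΩo : IsOpen Ω)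
    (U : EuclideanSpace ℝ (Fin n) → ℝ) (x y w : EuclideanSpace ℝ (Fin n)) (hx : x ∈ Ω)
    (hU : DifferentiableAt ℝ U x) (s : ℝ) (hs : 0 < s) (hys : ‖y - x‖ = s)
    (hyd : dBdry Ω y = dBdry Ω x + s) (a b : ℝ) (ha : 0 < a) (hb : 0 < b)
    (B r β α : ℝ) (hB : 0 < B) (hr : 0 < r) (hβ : 0 < β) (hα : 0 < α) (hαβ : α = 1 - β)
    (hmax : ∀ v ∈ closure Ω, dBdry Ω x ≤ dBdry Ω v →
      U v - thP a b (v - w) + GP B r β α (dBdry Ω v - dBdry Ω x) ≤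
      U x - thP a b (x - w) + GP B r β α (dBdry Ω x - dBdry Ω x)) : False := by
  set N := (1 / s) • (y - x) with hN
  set P := pgP a b (x - w) with hP
  have hN1 : ‖N‖ = 1 := by
    rw [hN, norm_smul, hys, Real.norm_of_nonneg (by positivity)]; field_simp
  rw [sub_self, GP_zero B r β α hr hα] at hmax
  have hline : HasDerivAt (fun t : ℝ => x + t • N) N 0 := by
    simpa using ((hasDerivAt_id (0:ℝ)).smul_const N).const_add x
  have hU' : HasFDerivAt U (fderiv ℝ U x) (x + (0:ℝ) • N) := by
    simpa using hU.hasFDerivAt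
  have hder := hU'.comp_hasDerivAt (0:ℝ) hline
  have hsub : (𝓝[>] (0:ℝ)) ≤ 𝓝[≠] 0 := nhdsWithin_mono 0 (fun t ht => ne_of_gt ht)
  have hsl := hder.tendsto_slope.mono_left hsub
  have ht0 : Tendsto (fun t : ℝ => t) (𝓝[>] (0:ℝ)) (𝓝 0) := tendsto_id.mono_left nhdsWithin_le_nhds
  have hlim := (hsl.neg.add_const (inner ℝ P N)).add (ht0.const_mul ((b / a) / 2))
  have hinf : Tendsto (fun t : ℝ => B * (r ^ β / α * t ^ (-β) - 1)) (𝓝[>] 0) atTop := by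
    refine Tendsto.const_mul_atTop hB ?_
    refine tendsto_atTop_add_const_right _ _ ?_
    exact Tendsto.const_mul_atTop (by positivity) (tendsto_rpow_neg_nhdsGT_zero (by linarith))
  refine not_tendsto_atTop_of_tendsto_nhds hlim (tendsto_atTop_mono' _ ?_ hinf)
  have hv0 : Tendsto (fun t : ℝ => x + t • N) (𝓝[>] 0) (𝓝 x) := by
    have : Continuous (fun t : ℝ => x + t • N) := by fun_prop
    have h := this.tendsto 0
    simp only [zero_smul, add_zero] at h
    exact h.mono_left nhdsWithin_le_nhds
  have h1 : ∀ᶠ t in 𝓝[>] (0:ℝ), t < s :=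
    (eventually_lt_nhds hs).filter_mono nhdsWithin_le_nhds
  filter_upwards [hv0.eventually (hΩo.mem_nhds hx), h1, self_mem_nhdsWithin] with t ht hts ht2
  have ht2' : 0 < t := ht2
  have hd : dBdry Ω x + t ≤ dBdry Ω (x + t • N) := by
    have := aux_dlip Ω y (x + t • N)
    have he : y - (x + t • N) = (s - t) • N := by
      have : y - x = s • N := by rw [hN, smul_smul]; field_simp; simp
      rw [sub_smul, ← this]; abel
    rw [he, norm_smul, hN1, Real.norm_of_nonneg (by linarith)] at this
    linarith
  have hm := hmax _ (subset_closure ht) (by linarith)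
  have hg1 := GP_mono B r β α hB hr hβ hα hαβ t (dBdry Ω (x + t • N) - dBdry Ω x) ht2'.le (by linarith)
  have hg2 := gP_le_GP B r β α hB hr hβ hα hαβ t
  have hq := thP_quad a b ha hb (x - w) (t • N)
  have he : x - w + t • N = x + t • N - w := by abel
  rw [he, inner_smul_right, norm_smul, hN1, Real.norm_of_nonneg ht2'.le, ← hP] at hq
  have hgt : gP B r β α t = t * (B * (r ^ β / α * t ^ (-β) - 1)) := by
    unfold gP
    have : t ^ α = t ^ (-β) * t := by
      conv_rhs => rw [← Real.rpow_add_one ht2'.ne']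
      congr 1; rw [hαβ]; ring
    rw [this]; field_simp
  simp only [slope, Function.comp, vsub_eq_sub, smul_eq_mul, zero_smul, add_zero, sub_zero]
  have hfin : t * (B * (r ^ β / α * t ^ (-β) - 1)) ≤
      t * (-(t⁻¹ * (U (x + t • N) - U x)) + inner ℝ P N + b / a / 2 * t) := by
    rw [← hgt]
    have : t * (-(t⁻¹ * (U (x + t • N) - U x)) + inner ℝ P N + b / a / 2 * t) =
      -(U (x + t • N) - U x) + t * inner ℝ P N + b / a / 2 * t ^ 2 := by field_simp
    rw [this]
    nlinarith
  exact le_of_mul_le_mul_left hfin ht2'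

set_option maxHeartbeats 1000000 in
theorem aux_pt {n : ℕ} (Ω : Set (EuclideanSpace ℝ (Fin n))) (hΩo : IsOpen Ω)
    (hne : (frontier Ω).Nonempty) (δ : ℝ)
    (hC : ContDiffOn ℝ 2 (dBdry Ω) {x ∈ Ω | dBdry Ω x ≤ δ})
    (p lam : ℝ) (hp : 2 < p) (hlam : 0 < lam)
    (f : EuclideanSpace ℝ (Fin n) → ℝ) (Lf : ℝ≥0)
    (hfLip : LipschitzOnWith Lf f (closure Ω)) (hf_bdry : ∀ x ∈ frontier Ω, f x = 0)
    (u : EuclideanSpace ℝ (Fin n) → ℝ) (hu0 : ∀ x ∈ closure Ω, 0 ≤ u x)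
    (hu_sup : ViscSupOn1 Ω lam p f u)
    (U : EuclideanSpace ℝ (Fin n) → ℝ) (e : ℝ) (he : 0 < e)
    (hU : ClassicalSolIn Ω lam p (e ^ 2) f U)
    (M κ ρ B s T δ' β α a b : ℝ) (hM : 0 ≤ M) (hfM : ∀ x ∈ closure Ω, f x ≤ M ^ p)
    (hκ : 0 < κ) (hρ : 0 < ρ) (hB : 0 < B) (hs : 0 < s) (hδ' : 0 < δ')
    (hβ : β = 1 / (p - 1)) (hαβ : α = 1 - β) (hb : b = 2 * M + 1) (ha : a = b * (e / κ))
    (hC1 : 2 * (ρ * e) + s < δ)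
    (hC2 : 4 * ρ * κ * (Lf * (2 * (ρ * e))) ^ (1 / p) ≤ B ^ 2)
    (hE3 : e * (β / ρ) * B + e ^ 2 * (n / s) * B ≤ (B / 2) ^ p)
    (hE4 : e ^ 2 * (n / s) * (4 * B) ≤ e / 8) (hBs : (β / ρ) * B * 4 ^ p ≤ 1 / 8)
    (hLρ : Lf * ρ ≤ 1 / 4) (hδr : δ' ≤ ρ * e) (hLδ : Lf * δ' ≤ e / 4)
    (hT1 : 2 * (Lf * M) / κ + n * κ ≤ T) (hT2 : 3 / 4 + n * κ ≤ T)
    (x y : EuclideanSpace ℝ (Fin n)) (hx : x ∈ Ω) (hxd : δ' < dBdry Ω x) (hy : y ∈ closure Ω)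
    (hminy : ∀ w ∈ closure Ω, min (u y) (SP Ω Lf p y) + thP a b (x - y) ≤
      min (u w) (SP Ω Lf p w) + thP a b (x - w))
    (hmax : ∀ v ∈ closure Ω, δ' ≤ dBdry Ω v →
      U v - thP a b (v - y) + GP B (ρ * e) β α (dBdry Ω v - δ') ≤
      U x - thP a b (x - y) + GP B (ρ * e) β α (dBdry Ω x - δ')) :
    lam * (U x - min (u y) (SP Ω Lf p y)) ≤ T * e := by
  have hb0 : 0 < b := by linarith
  have ha0 : 0 < a := by rw [ha]; positivity
  have hba : b / a = κ / e := by rw [ha]; field_simp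
  have hp1 : 0 < p - 1 := by linarith
  have hβ0 : 0 < β := by rw [hβ]; positivity
  have hβ1 : β < 1 := by rw [hβ, div_lt_one hp1]; linarith
  have hα0 : 0 < α := by linarith
  have hr : 0 < ρ * e := by positivity
  have hxc := subset_closure hx
  have hY := aux_Y Ω hΩo hne p lam hp hlam f Lf hfLip hf_bdry u hu0 hu_sup a b ha0 hb0 x y hy hminy
  have hSn : ∀ w, 0 ≤ SP Ω Lf p w := fun w => by
    have := aux_dnonneg Ω w
    unfold SP; positivity
  have hut : 0 ≤ min (u y) (SP Ω Lf p y) := le_min (hu0 y hy) (hSn y)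
  set ut := min (u y) (SP Ω Lf p y) with hutdef
  set P := pgP a b (x - y) with hP
  have hcd : ContDiffAt ℝ 2 U x := hU.1.contDiffAt (hΩo.mem_nhds hx)
  have heq := hU.2 x hx
  have hxv : Tendsto (fun v : EuclideanSpace ℝ (Fin n) => x + v) (𝓝 0) (𝓝 x) := by
    have : Continuous (fun v : EuclideanSpace ℝ (Fin n) => x + v) := by fun_prop
    simpa using this.tendsto 0
  have hloc : ∀ᶠ v in 𝓝 (0 : EuclideanSpace ℝ (Fin n)),
      U (x + v) ≤ U x + inner ℝ P v + (κ / e) / 2 * ‖v‖ ^ 2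
        - (GP B (ρ * e) β α (dBdry Ω (x + v) - δ') - GP B (ρ * e) β α (dBdry Ω x - δ')) := by
    filter_upwards [hxv.eventually (hΩo.mem_nhds hx),
      hxv.eventually ((aux_dcont Ω).continuousAt.eventually (eventually_gt_nhds hxd))] with v h1 h2
    have h3 := hmax _ (subset_closure h1) (le_of_lt h2)
    have h4 := thP_quad a b ha0 hb0 (x - y) v
    rw [hba, ← hP, sub_add_eq_add_sub] at h4
    linarith
  rcases le_or_gt (dBdry Ω x - δ') (ρ * e) with hτ | hτ
  · -- boundary strip
    set τ := dBdry Ω x - δ' with hτdef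
    have hτ0 : 0 < τ := by linarith
    obtain ⟨c, hcs, hcd'⟩ := aux_center Ω hΩo hne δ hC x hx s hs (by linarith)
    set N := (1 / s) • (c - x) with hN
    have hN1 : ‖N‖ = 1 := by
      rw [hN, norm_smul, hcs, Real.norm_of_nonneg (by positivity)]; field_simp
    have hcx : c - x = s • N := by rw [hN, smul_smul]; field_simp; simp
    have hq0 : Tendsto (fun v : EuclideanSpace ℝ (Fin n) =>
        τ + inner ℝ N v - (1 / s) / 2 * ‖v‖ ^ 2) (𝓝 0) (𝓝 τ) := by
      have : Continuous (fun v : EuclideanSpace ℝ (Fin n) =>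
        τ + inner ℝ N v - (1 / s) / 2 * ‖v‖ ^ 2) := by fun_prop
      simpa using this.tendsto 0
    have hsec := aux_2nd U x P N hcd (κ / e) (1 / s) τ
      (B * ((ρ * e) ^ β * ((α - 1) * τ ^ (α - 1 - 1)))) (by rw [hN1]; ring)
      (gP B (ρ * e) β α) (fun t => B * ((ρ * e) ^ β * t ^ (α - 1) - 1))
      (by filter_upwards [eventually_gt_nhds hτ0] with t ht using gP_deriv B (ρ * e) β α hα0 t ht)
      (gP_deriv2 B (ρ * e) β α τ hτ0)
      (by
        filter_upwards [hloc, hq0.eventually (eventually_gt_nhds hτ0)] with v h1 h2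
        have hd : τ + inner ℝ N v - (1 / s) / 2 * ‖v‖ ^ 2 ≤ dBdry Ω (x + v) - δ' := by
          have h3 := aux_dlip Ω c (x + v)
          have h4 : c - (x + v) = s • N - v := by rw [← hcx]; abel
          have h5 : ‖s • N - v‖ ^ 2 = s ^ 2 + (‖v‖ ^ 2 - 2 * s * inner ℝ N v) := by
            rw [norm_sub_sq_real, norm_smul, hN1, inner_smul_left, Real.norm_of_nonneg hs.le]
            simp; ring
          have h6 := aux_sqrt_le hs (X := ‖v‖ ^ 2 - 2 * s * inner ℝ N v) (by rw [← h5]; positivity)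
          rw [← h5, Real.sqrt_sq (norm_nonneg _)] at h6
          have h7 : (‖v‖ ^ 2 - 2 * s * inner ℝ N v) / (2 * s) =
            (1 / s) / 2 * ‖v‖ ^ 2 - inner ℝ N v := by field_simp
          rw [h4] at h3
          linarith
        have hg1 := GP_mono B (ρ * e) β α hB hr hβ0 hα0 hαβ _ _ (le_of_lt h2) hd
        have hg2 := gP_le_GP B (ρ * e) β α hB hr hβ0 hα0 hαβ
          (τ + inner ℝ N v - (1 / s) / 2 * ‖v‖ ^ 2)
        have hg3 : GP B (ρ * e) β α τ = gP B (ρ * e) β α τ := by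
          unfold GP; rw [min_eq_left hτ]
        linarith)
    obtain ⟨hgrad, hlap⟩ := hsec
    have hD := aux_D p β α (ρ * e) τ B hp hβ hαβ hr hτ0
    set X := (ρ * e) ^ β * τ ^ (α - 1) with hX
    have hX1 : 1 ≤ X := gP_X hr hτ0 hβ0 hαβ hτ
    -- bound on P
    have hPB : ‖P‖ ≤ B := by
      have h1 := hminy x hxc
      rw [sub_self, thP_zero a b ha0, add_zero] at h1
      have h2 := min_le_right (u x) (SP Ω Lf p x)
      have h3 := pgP_sq a b ha0 hb0 (x - y)
      rw [hba, ← hP] at h3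
      have hdx : dBdry Ω x ≤ 2 * (ρ * e) := by linarith
      have hdx0 := aux_dnonneg Ω x
      have h4 : SP Ω Lf p x ≤ 2 * (ρ * e) * (Lf * (2 * (ρ * e))) ^ (1 / p) := by
        unfold SP
        have : ((Lf:ℝ) * dBdry Ω x) ^ (1 / p) ≤ (Lf * (2 * (ρ * e))) ^ (1 / p) := by
          apply Real.rpow_le_rpow (by positivity)
          · gcongr
          · positivity
        exact mul_le_mul hdx this (by positivity) (by positivity)
      have h5 : ‖P‖ ^ 2 ≤ B ^ 2 := by
        calc ‖P‖ ^ 2 ≤ 2 * (κ / e) * thP a b (x - y) := h3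
          _ ≤ 2 * (κ / e) * (2 * (ρ * e) * (Lf * (2 * (ρ * e))) ^ (1 / p)) := by
            gcongr; linarith
          _ = 4 * ρ * κ * (Lf * (2 * (ρ * e))) ^ (1 / p) := by
            generalize ((Lf:ℝ) * (2 * (ρ * e))) ^ (1 / p) = Y; field_simp; ring
          _ ≤ B ^ 2 := hC2
      exact (pow_le_pow_iff_left₀ (norm_nonneg _) hB.le (by norm_num)).1 h5
    have hbr := aux_bracket p β ρ B e (n / s) X P N hp hβ0 hρ hB he (by positivity) hX1 hPB hN1
      hE3 hE4 hBs
    rw [hgrad] at heq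
    have hlap' : e ^ 2 * lapl U x ≤ n * κ * e + e ^ 2 * (n / s) * (B * (X - 1))
        + e * (β / ρ) * B * X ^ p := by
      calc e ^ 2 * lapl U x ≤ e ^ 2 * (n * (κ / e) + n * (1 / s) * (B * (X - 1))
            - (B * ((ρ * e) ^ β * ((α - 1) * τ ^ (α - 1 - 1))))) := by gcongr
        _ = e ^ 2 * (n * (κ / e) + n * (1 / s) * (B * (X - 1))
            + β / (ρ * e) * B * X ^ p) := by rw [← hD]; ring
        _ = _ := by field_simp
    have hfx := aux_f_le Ω hne f Lf hfLip hf_bdry x hxc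
    have hfx2 : (Lf:ℝ) * dBdry Ω x ≤ e / 4 + e / 4 := by
      have : (Lf:ℝ) * dBdry Ω x ≤ Lf * (ρ * e + δ') := by gcongr; linarith
      have h2 : (Lf:ℝ) * ρ * e ≤ 1 / 4 * e := by gcongr
      have h3 : (Lf:ℝ) * (ρ * e + δ') = Lf * ρ * e + Lf * δ' := by ring
      linarith only [this, h2, h3, hLδ]
    have h1 : lam * U x ≤ (3 / 4 + n * κ) * e := by linarith
    have h2 : (3 / 4 + n * κ) * e ≤ T * e := by gcongr
    have h3 := mul_nonneg hlam.le hut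
    linarith
  · -- interior
    have hsec := aux_2nd U x P 0 hcd (κ / e) 0 0 0 (by simp) (fun _ => 0) (fun _ => 0)
      (Filter.Eventually.of_forall fun t => hasDerivAt_const t 0) (hasDerivAt_const _ _)
      (by
        have hτ' : ρ * e + δ' < dBdry Ω x := by linarith
        filter_upwards [hloc, hxv.eventually
          ((aux_dcont Ω).continuousAt.eventually (eventually_gt_nhds hτ'))] with v h1 h2
        have h2' : ρ * e ≤ dBdry Ω (x + v) - δ' := by linarith
        unfold GP at h1
        rw [min_eq_right h2', min_eq_right hτ.le] at h1
        linarith)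
    obtain ⟨hgrad, hlap⟩ := hsec
    simp at hgrad hlap
    rw [hgrad] at heq
    have hlap' : e ^ 2 * lapl U x ≤ n * κ * e := by
      calc e ^ 2 * lapl U x ≤ e ^ 2 * (n * (κ / e)) := by gcongr
        _ = _ := by field_simp
    have hut' := mul_nonneg hlam.le hut
    rcases le_or_gt (f x) (‖P‖ ^ p) with hc | hc
    · have h2 : (3 / 4 + n * κ) * e ≤ T * e := by gcongr
      nlinarith
    · have hPM : ‖P‖ ≤ M := by
        have h1 := hc.le.trans (hfM x hxc)
        exact (Real.rpow_le_rpow_iff (norm_nonneg _) hM (by linarith)).1 h1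
      have hz := pgP_small a b M ha0 hM hb (x - y) hPM
      have hab : a / b = e / κ := by rw [ha]; field_simp
      rw [hab] at hz
      have hL := hfLip.dist_le_mul x hxc y hy
      rw [Real.dist_eq, dist_eq_norm] at hL
      have hL1 := (le_abs_self _).trans hL
      have hL2 : (Lf:ℝ) * ‖x - y‖ ≤ Lf * (2 * (e / κ) * M) := by gcongr
      have hL3 : (Lf:ℝ) * (2 * (e / κ) * M) = 2 * (Lf * M) / κ * e := by field_simp
      have h2 : (2 * (Lf * M) / κ + n * κ) * e ≤ T * e := by gcongr
      linarith

theorem closure_induction_le {n : ℕ} {Ω : Set (EuclideanSpace ℝ (Fin n))}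
    {f : EuclideanSpace ℝ (Fin n) → ℝ} {c : ℝ} (hfc : ContinuousOn f (closure Ω))
    (h : ∀ x ∈ Ω, f x ≤ c) (x : EuclideanSpace ℝ (Fin n)) (hx : x ∈ closure Ω) : f x ≤ c := by
  have : x ∈ closure Ω := hx
  rw [mem_closure_iff_nhdsWithin_neBot] at this
  have ht : Tendsto f (𝓝[Ω] x) (𝓝 (f x)) := (hfc x hx).mono_left (nhdsWithin_mono x subset_closure)
  refine le_of_tendsto ht ?_
  filter_upwards [self_mem_nhdsWithin] with y hy using h y hy

theorem aux_core {n : ℕ} (Ω : Set (EuclideanSpace ℝ (Fin n))) (hΩo : IsOpen Ω)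
    (hΩb : IsBounded Ω)
    (hne : (frontier Ω).Nonempty) (δ : ℝ)
    (hC : ContDiffOn ℝ 2 (dBdry Ω) {x ∈ Ω | dBdry Ω x ≤ δ})
    (p lam : ℝ) (hp : 2 < p) (hlam : 0 < lam)
    (f : EuclideanSpace ℝ (Fin n) → ℝ) (Lf : ℝ≥0)
    (hfLip : LipschitzOnWith Lf f (closure Ω)) (hf_bdry : ∀ x ∈ frontier Ω, f x = 0)
    (u : EuclideanSpace ℝ (Fin n) → ℝ) (hu_cont : ContinuousOn u (closure Ω))
    (hu0 : ∀ x ∈ closure Ω, 0 ≤ u x)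
    (hu_sup : ViscSupOn1 Ω lam p f u)
    (U : EuclideanSpace ℝ (Fin n) → ℝ) (hU_cont : ContinuousOn U (closure Ω)) (e : ℝ) (he : 0 < e)
    (hU : ClassicalSolIn Ω lam p (e ^ 2) f U)
    (M κ ρ B s T δ' β α a b : ℝ) (hM : 0 ≤ M) (hfM : ∀ x ∈ closure Ω, f x ≤ M ^ p)
    (hκ : 0 < κ) (hρ : 0 < ρ) (hB : 0 < B) (hs : 0 < s) (hδ' : 0 < δ')
    (hβ : β = 1 / (p - 1)) (hαβ : α = 1 - β) (hb : b = 2 * M + 1) (ha : a = b * (e / κ))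
    (hC1 : 2 * (ρ * e) + s < δ)
    (hC2 : 4 * ρ * κ * (Lf * (2 * (ρ * e))) ^ (1 / p) ≤ B ^ 2)
    (hE3 : e * (β / ρ) * B + e ^ 2 * (n / s) * B ≤ (B / 2) ^ p)
    (hE4 : e ^ 2 * (n / s) * (4 * B) ≤ e / 8) (hBs : (β / ρ) * B * 4 ^ p ≤ 1 / 8)
    (hLρ : Lf * ρ ≤ 1 / 4) (hδr : δ' ≤ ρ * e) (hLδ : Lf * δ' ≤ e / 4)
    (hT1 : 2 * (Lf * M) / κ + n * κ ≤ T) (hT2 : 3 / 4 + n * κ ≤ T)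
    (x₁ : EuclideanSpace ℝ (Fin n)) (hx₁ : x₁ ∈ closure Ω) (hxd₁ : δ' ≤ dBdry Ω x₁) :
    U x₁ - u x₁ ≤ (B * ρ / α + T / lam) * e := by
  have hb0 : 0 < b := by linarith
  have ha0 : 0 < a := by rw [ha]; positivity
  have hp1 : 0 < p - 1 := by linarith
  have hβ0 : 0 < β := by rw [hβ]; positivity
  have hβ1 : β < 1 := by rw [hβ, div_lt_one hp1]; linarith
  have hα0 : 0 < α := by linarith
  have hr : 0 < ρ * e := by positivity
  have hcl : IsCompact (closure Ω) := hΩb.isCompact_closure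
  set K : Set (EuclideanSpace ℝ (Fin n)) := closure Ω ∩ {x | δ' ≤ dBdry Ω x} with hK
  have hKc : IsCompact K := hcl.inter_right (isClosed_le continuous_const (aux_dcont Ω))
  have hdc := aux_dcont Ω
  have hSc : Continuous (SP Ω Lf p) := by
    unfold SP
    exact hdc.mul ((continuous_const.mul hdc).rpow_const (fun _ => Or.inr (by positivity)))
  have hGc : Continuous (GP B (ρ * e) β α) := by
    have := gP_cont B (ρ * e) β α hα0
    have h2 : Continuous (fun t : ℝ => min t (ρ * e)) := by fun_prop
    exact this.comp h2
  have hΦ : ContinuousOn (fun q : EuclideanSpace ℝ (Fin n) × EuclideanSpace ℝ (Fin n) =>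
      U q.1 - min (u q.2) (SP Ω Lf p q.2) - thP a b (q.1 - q.2)
        + GP B (ρ * e) β α (dBdry Ω q.1 - δ')) (K ×ˢ closure Ω) := by
    have h1 : ContinuousOn (fun q : EuclideanSpace ℝ (Fin n) × EuclideanSpace ℝ (Fin n) => U q.1)
        (K ×ˢ closure Ω) := hU_cont.comp continuousOn_fst (fun q hq => hq.1.1)
    have h2 : ContinuousOn (fun q : EuclideanSpace ℝ (Fin n) × EuclideanSpace ℝ (Fin n) => u q.2)
        (K ×ˢ closure Ω) := hu_cont.comp continuousOn_snd (fun q hq => hq.2)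
    have h3 : Continuous (fun q : EuclideanSpace ℝ (Fin n) × EuclideanSpace ℝ (Fin n) =>
      SP Ω Lf p q.2) := hSc.comp continuous_snd
    have h4 : Continuous (fun q : EuclideanSpace ℝ (Fin n) × EuclideanSpace ℝ (Fin n) =>
      thP a b (q.1 - q.2)) := (thP_cont a b).comp (continuous_fst.sub continuous_snd)
    have h5 : Continuous (fun q : EuclideanSpace ℝ (Fin n) × EuclideanSpace ℝ (Fin n) =>
      GP B (ρ * e) β α (dBdry Ω q.1 - δ')) :=
        hGc.comp ((hdc.comp continuous_fst).sub continuous_const)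
    exact ((h1.sub (h2.inf h3.continuousOn)).sub h4.continuousOn).add h5.continuousOn
  obtain ⟨⟨x, y⟩, ⟨hxK, hy⟩, hmax⟩ := (hKc.prod hcl).exists_isMaxOn
    ⟨(x₁, x₁), ⟨⟨hx₁, hxd₁⟩, hx₁⟩⟩ hΦ
  simp only at hxK hy
  have hmax' : ∀ v ∈ closure Ω, δ' ≤ dBdry Ω v → ∀ w ∈ closure Ω,
      U v - min (u w) (SP Ω Lf p w) - thP a b (v - w) + GP B (ρ * e) β α (dBdry Ω v - δ') ≤
      U x - min (u y) (SP Ω Lf p y) - thP a b (x - y) + GP B (ρ * e) β α (dBdry Ω x - δ') :=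
    fun v hv hv2 w hw => hmax (show (v, w) ∈ K ×ˢ closure Ω from ⟨⟨hv, hv2⟩, hw⟩)
  have hxd : δ' ≤ dBdry Ω x := hxK.2
  have hxΩ : x ∈ Ω := aux_mem_of_pos Ω hΩo x hxK.1 (by linarith)
  have hm1 : ∀ v ∈ closure Ω, δ' ≤ dBdry Ω v →
      U v - thP a b (v - y) + GP B (ρ * e) β α (dBdry Ω v - δ') ≤
      U x - thP a b (x - y) + GP B (ρ * e) β α (dBdry Ω x - δ') := fun v hv hv2 => by
    have := hmax' v hv hv2 y hy
    linarith
  have hm2 : ∀ w ∈ closure Ω, min (u y) (SP Ω Lf p y) + thP a b (x - y) ≤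
      min (u w) (SP Ω Lf p w) + thP a b (x - w) := fun w hw => by
    have := hmax' x hxK.1 hxd w hw
    linarith
  have hkey : lam * (U x - min (u y) (SP Ω Lf p y)) ≤ T * e := by
    rcases hxd.eq_or_lt with heq | hlt
    · exfalso
      obtain ⟨c, hc1, hc2⟩ := aux_center Ω hΩo hne δ hC x hxΩ s hs (by linarith)
      subst heq
      exact aux_edge Ω hΩo U x c y hxΩ
        ((hU.1.contDiffAt (hΩo.mem_nhds hxΩ)).differentiableAt (by norm_num)) s hs hc1 hc2
        a b ha0 hb0 B (ρ * e) β α hB hr hβ0 hα0 hαβ hm1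
    · exact aux_pt Ω hΩo hne δ hC p lam hp hlam f Lf hfLip hf_bdry u hu0 hu_sup U e he hU
        M κ ρ B s T δ' β α a b hM hfM hκ hρ hB hs hδ' hβ hαβ hb ha hC1 hC2 hE3 hE4 hBs hLρ
        hδr hLδ hT1 hT2 x y hxΩ hlt hy hm2 hm1
  have h1 := hmax' x₁ hx₁ hxd₁ x₁ hx₁
  rw [sub_self, thP_zero a b ha0] at h1
  have h2 := GP_mono B (ρ * e) β α hB hr hβ0 hα0 hαβ 0 (dBdry Ω x₁ - δ') le_rfl (by linarith)
  rw [GP_zero B (ρ * e) β α hr hα0] at h2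
  have h3 := GP_le B (ρ * e) β α hB hr hβ0 hα0 hαβ (dBdry Ω x - δ') (by linarith)
  have h4 := min_le_left (u x₁) (SP Ω Lf p x₁)
  have h5 := thP_nonneg a b ha0 hb0 (x - y)
  have h6 : U x - min (u y) (SP Ω Lf p y) ≤ T / lam * e := by
    rw [div_mul_eq_mul_div, le_div_iff₀ hlam]; linarith
  have h7 : (B * ρ / α + T / lam) * e = B * (ρ * e) / α + T / lam * e := by ring
  rw [h7]
  linarith

theorem aux_u_nonneg {n : ℕ} (Ω : Set (EuclideanSpace ℝ (Fin n)))
    (hΩb : IsBounded Ω) (p lam : ℝ) (hp : 2 < p) (hlam : 0 < lam)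
    (f : EuclideanSpace ℝ (Fin n) → ℝ) (hf_nonneg : ∀ x ∈ closure Ω, 0 ≤ f x)
    (u : EuclideanSpace ℝ (Fin n) → ℝ) (hu_cont : ContinuousOn u (closure Ω))
    (hu_sup : ViscSupOn1 Ω lam p f u) : ∀ x ∈ closure Ω, 0 ≤ u x := by
  intro x hx
  obtain ⟨z, hz, hmin⟩ := hΩb.isCompact_closure.exists_isMinOn ⟨x, hx⟩ hu_cont
  have h := hu_sup z hz (fun _ => 0) contDiff_const (by
    filter_upwards [self_mem_nhdsWithin] with w hw
    simpa using hmin hw)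
  have hg : gradient (fun _ : EuclideanSpace ℝ (Fin n) => (0:ℝ)) z = 0 := by
    simp [gradient]
  rw [hg, norm_zero, Real.zero_rpow (by linarith)] at h
  have h0 := hf_nonneg z hz
  have h1 : 0 ≤ u z := by
    by_contra hc
    have := mul_neg_of_pos_of_neg hlam (not_le.1 hc)
    linarith
  exact h1.trans (hmin hx)

theorem aux_delta {n : ℕ} (Ω : Set (EuclideanSpace ℝ (Fin n))) (hC2 : 0 < deltaOm Ω) :
    (frontier Ω).Nonempty ∧ ∃ δ > 0, ContDiffOn ℝ 2 (dBdry Ω) {x ∈ Ω | dBdry Ω x ≤ δ} := by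
  have hnon : {δ : ℝ | 0 < δ ∧ δ < sSup (dBdry Ω '' Ω) ∧
    ContDiffOn ℝ 2 (dBdry Ω) {x ∈ Ω | dBdry Ω x ≤ δ}}.Nonempty := by
    by_contra h
    rw [Set.not_nonempty_iff_eq_empty] at h
    unfold deltaOm at hC2
    rw [h, Real.sSup_empty] at hC2
    simp at hC2
  obtain ⟨δ, h1, h2, h3⟩ := hnon
  refine ⟨?_, δ, h1, h3⟩
  by_contra h
  rw [Set.not_nonempty_iff_eq_empty] at h
  have : sSup (dBdry Ω '' Ω) ≤ 0 := by
    apply Real.sSup_nonpos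
    rintro _ ⟨x, -, rfl⟩
    simp [dBdry, h]
  linarith

theorem aux_osc {n : ℕ} (Ω : Set (EuclideanSpace ℝ (Fin n))) (hΩb : IsBounded Ω)
    (hne : (frontier Ω).Nonempty)
    (f : EuclideanSpace ℝ (Fin n) → ℝ) (hfc : ContinuousOn f (closure Ω))
    (hf_bdry : ∀ x ∈ frontier Ω, f x = 0) :
    ∀ x ∈ closure Ω, f x ≤ oscOn f Ω := by
  have hcomp := hΩb.isCompact_closure.image_of_continuousOn hfc
  have hA : BddAbove (f '' Ω) := hcomp.bddAbove.mono (image_mono subset_closure)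
  have hBb : BddBelow (f '' Ω) := hcomp.bddBelow.mono (image_mono subset_closure)
  obtain ⟨z, hz⟩ := hne
  have hzc := frontier_subset_closure hz
  have h1 : ∀ x ∈ closure Ω, f x ≤ sSup (f '' Ω) :=
    fun x hx => closure_induction_le hfc (fun y hy => le_csSup hA ⟨y, hy, rfl⟩) x hx
  have h2 : sInf (f '' Ω) ≤ f z := by
    have := closure_induction_le (Ω := Ω) (f := fun x => - f x) (c := - sInf (f '' Ω)) hfc.neg
      (fun y hy => neg_le_neg (csInf_le hBb ⟨y, hy, rfl⟩)) z hzc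
    linarith
  rw [hf_bdry z hz] at h2
  intro x hx
  have := h1 x hx
  unfold oscOn
  linarith

/-- Upper bound `max_{cl Ω} (u^ε − u) ≤ Λ'·√ε` for nonnegative Lipschitz data
vanishing on the boundary, with
`Λ' = 2^{α_p}/α_p + (1 + (n+2)·((osc_Ω f)^{1/p}·‖f‖_Lip)^{1/2})/λ`, `α_p = (p−2)/(p−1)`.
The `C²`-boundary assumption is encoded by `0 < δ_Ω`. -/
theorem upper_rate_sqrt_eps {n : ℕ} (Ω : Set (EuclideanSpace ℝ (Fin n)))
    (hΩo : IsOpen Ω) (hΩb : IsBounded Ω) (hΩne : Ω.Nonempty)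
    (hC2 : 0 < deltaOm Ω)
    (p lam : ℝ) (hp : 2 < p) (hlam : 0 < lam)
    (f : EuclideanSpace ℝ (Fin n) → ℝ) (Lf : ℝ≥0)
    (hfLip : LipschitzOnWith Lf f (closure Ω))
    (hf_nonneg : ∀ x ∈ closure Ω, 0 ≤ f x)
    (hf_bdry : ∀ x ∈ frontier Ω, f x = 0)
    -- `u` is the state-constraint viscosity solution of `λu + |Du|^p = f`
    (u : EuclideanSpace ℝ (Fin n) → ℝ) (hu_cont : ContinuousOn u (closure Ω))
    (hu_sub : ViscSubIn1 Ω lam p f u) (hu_sup : ViscSupOn1 Ω lam p f u)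
    -- `uε ε` is the maximal solution of the state-constraint problem for
    -- `λu + |Du|^p − εΔu = f`
    (uε : ℝ → EuclideanSpace ℝ (Fin n) → ℝ)
    (huε : ∀ ε : ℝ, 0 < ε →
      ContinuousOn (uε ε) (closure Ω) ∧ ClassicalSolIn Ω lam p ε f (uε ε) ∧
      ViscSupOn Ω lam p ε f (uε ε) ∧ BdryStrict Ω ((p - 2) / (p - 1)) (uε ε)) :
    ∃ ε₀ > (0:ℝ), ∀ ε : ℝ, 0 < ε → ε < ε₀ → ∀ x ∈ closure Ω,
      uε ε x - u x ≤
        ((2 : ℝ) ^ ((p - 2) / (p - 1)) / ((p - 2) / (p - 1))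
            + (1 + ((n : ℝ) + 2) * ((oscOn f Ω) ^ (1 / p) * (Lf : ℝ)) ^ ((1 : ℝ) / 2)) / lam)
          * Real.sqrt ε := by
  obtain ⟨hne, δ, hδ, hC⟩ := aux_delta Ω hC2
  have hu0 := aux_u_nonneg Ω hΩb p lam hp hlam f hf_nonneg u hu_cont hu_sup
  have hosc := aux_osc Ω hΩb hne f hfLip.continuousOn hf_bdry
  have hosc0 : 0 ≤ oscOn f Ω := by
    obtain ⟨z, hz⟩ := hΩne
    exact (hf_nonneg z (subset_closure hz)).trans (hosc z (subset_closure hz))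
  have hp0 : 0 < p := by linarith
  have hp1 : 0 < p - 1 := by linarith
  have hαe : (p - 2) / (p - 1) = 1 - 1 / (p - 1) := by field_simp; ring
  set α := (p - 2) / (p - 1) with hα
  have hα0 : 0 < α := div_pos (by linarith) hp1
  set β := 1 / (p - 1) with hβ
  have hβ0 : 0 < β := by positivity
  set M := (oscOn f Ω) ^ (1 / p) with hM
  have hM0 : 0 ≤ M := by positivity
  have hMp : M ^ p = oscOn f Ω := by
    rw [hM, ← Real.rpow_mul hosc0, one_div, inv_mul_cancel₀ hp0.ne', Real.rpow_one]
  rw [← Real.sqrt_eq_rpow]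
  have hL0 : (0:ℝ) ≤ Lf := Lf.2
  set S := Real.sqrt (M * Lf) with hS
  have hS0 : 0 ≤ S := Real.sqrt_nonneg _
  have hSS : S * S = M * Lf := Real.mul_self_sqrt (by positivity)
  have hn0 : (0:ℝ) ≤ n := Nat.cast_nonneg n
  obtain ⟨κ, hκ⟩ : ∃ κ : ℝ, κ = S + 1 / (4 * (n + 1)) := ⟨_, rfl⟩
  have hκ1 : 0 < 1 / (4 * ((n:ℝ) + 1)) := by positivity
  have hκ0 : 0 < κ := by linarith
  have hnκ : n * κ ≤ n * S + 1 / 4 := by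
    have : (n:ℝ) * (1 / (4 * (n + 1))) ≤ 1 / 4 := by
      rw [mul_one_div, div_le_div_iff₀ (by positivity) (by norm_num)]; linarith
    rw [hκ, mul_add]; linarith
  have hT2 : 3 / 4 + n * κ ≤ 1 + ((n:ℝ) + 2) * S := by nlinarith
  have hT1 : 2 * (Lf * M) / κ + n * κ ≤ 1 + ((n:ℝ) + 2) * S := by
    have : 2 * (Lf * M) / κ ≤ 2 * S := by
      rw [div_le_iff₀ hκ0]
      have : S * S ≤ S * κ := mul_le_mul_of_nonneg_left (by linarith) hS0
      nlinarith
    linarith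
  obtain ⟨ρ, hρ⟩ : ∃ ρ : ℝ, ρ = 1 / (4 * (Lf + 1)) := ⟨_, rfl⟩
  have hρ0 : 0 < ρ := by rw [hρ]; positivity
  have hLρ : (Lf:ℝ) * ρ ≤ 1 / 4 := by
    rw [hρ, mul_one_div, div_le_div_iff₀ (by positivity) (by norm_num)]; linarith
  obtain ⟨B, hBdef⟩ : ∃ B : ℝ, B = min (1 / ρ) (1 / 8 / (β / ρ * 4 ^ p)) := ⟨_, rfl⟩
  have h4p : (0:ℝ) < 4 ^ p := by positivity
  have hB0 : 0 < B := by rw [hBdef]; exact lt_min (by positivity) (by positivity)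
  have hBρ : B * ρ ≤ 1 := by
    have : B ≤ 1 / ρ := by rw [hBdef]; exact min_le_left _ _
    rwa [le_div_iff₀ hρ0] at this
  have hBs : (β / ρ) * B * 4 ^ p ≤ 1 / 8 := by
    have : B ≤ 1 / 8 / (β / ρ * 4 ^ p) := by rw [hBdef]; exact min_le_right _ _
    rw [le_div_iff₀ (by positivity)] at this
    linarith
  have hs0 : 0 < δ / 2 := by positivity
  have hev : ∀ᶠ e in 𝓝 (0:ℝ), 2 * (ρ * e) + δ / 2 < δ ∧
      4 * ρ * κ * (Lf * (2 * (ρ * e))) ^ (1 / p) < B ^ 2 ∧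
      e * (β / ρ) * B + e ^ 2 * (n / (δ / 2)) * B < (B / 2) ^ p ∧
      e * (n / (δ / 2)) * (4 * B) < 1 / 8 := by
    have c1 : Continuous (fun e : ℝ => 2 * (ρ * e) + δ / 2) := by fun_prop
    have c2 : Continuous (fun e : ℝ => 4 * ρ * κ * (Lf * (2 * (ρ * e))) ^ (1 / p)) := by
      have : Continuous (fun e : ℝ => (Lf * (2 * (ρ * e)) : ℝ)) := by fun_prop
      exact continuous_const.mul (this.rpow_const (fun _ => Or.inr (by positivity)))
    have c3 : Continuous (fun e : ℝ => e * (β / ρ) * B + e ^ 2 * (n / (δ / 2)) * B) := by fun_prop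
    have c4 : Continuous (fun e : ℝ => e * (n / (δ / 2)) * (4 * B)) := by fun_prop
    refine (c1.continuousAt.eventually_lt continuousAt_const ?_).and
      ((c2.continuousAt.eventually_lt continuousAt_const ?_).and
      ((c3.continuousAt.eventually_lt continuousAt_const ?_).and
      (c4.continuousAt.eventually_lt continuousAt_const ?_)))
    · simp; linarith
    · have : (0:ℝ) ^ (1 / p) = 0 := Real.zero_rpow (by positivity)
      simp only [mul_zero, this]; positivity
    · simp; positivity
    · simp
  have hsq : Tendsto Real.sqrt (𝓝 0) (𝓝 0) := by
    simpa using Real.continuous_sqrt.tendsto 0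
  obtain ⟨ε₀, hε₀, hball⟩ := Metric.eventually_nhds_iff.1 (hsq.eventually hev)
  refine ⟨ε₀, hε₀, fun ε hε hεε₀ => ?_⟩
  have hb := @hball ε (by rw [Real.dist_eq, sub_zero, abs_of_pos hε]; exact hεε₀)
  obtain ⟨hUc, hUs, -, -⟩ := huε ε hε
  have he0 : 0 < Real.sqrt ε := Real.sqrt_pos.2 hε
  have hee : Real.sqrt ε ^ 2 = ε := Real.sq_sqrt hε.le
  generalize Real.sqrt ε = e at hb he0 hee ⊢
  obtain ⟨hb1, hb2, hb3, hb4⟩ := hb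
  have hUs : ClassicalSolIn Ω lam p (e ^ 2) f (uε ε) := by rw [hee]; exact hUs
  have hmain : ∀ x ∈ Ω, uε ε x - u x ≤
      (2 ^ α / α + (1 + ((n:ℝ) + 2) * S) / lam) * e := by
    intro x hx
    have hdx := aux_pos_of_mem Ω hΩo hne x hx
    have hδ'0 : 0 < min (dBdry Ω x) (ρ * e) := lt_min hdx (by positivity)
    have hδr : min (dBdry Ω x) (ρ * e) ≤ ρ * e := min_le_right _ _
    have hcore := aux_core Ω hΩo hΩb hne δ hC p lam hp hlam f Lf hfLip hf_bdry u hu_cont hu0 hu_sup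
      (uε ε) hUc e he0 hUs M κ ρ B (δ / 2) (1 + ((n:ℝ) + 2) * S) (min (dBdry Ω x) (ρ * e)) β α
      ((2 * M + 1) * (e / κ)) (2 * M + 1) hM0 (fun x hx => by rw [hMp]; exact hosc x hx)
      hκ0 hρ0 hB0 hs0 hδ'0 hβ hαe rfl rfl hb1 hb2.le hb3.le
      (by
        have := mul_le_mul_of_nonneg_left hb4.le he0.le
        calc e ^ 2 * (n / (δ / 2)) * (4 * B) = e * (e * (n / (δ / 2)) * (4 * B)) := by ring
          _ ≤ e * (1 / 8) := this
          _ = e / 8 := by ring) hBs hLρ hδr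
      (by
        calc (Lf:ℝ) * min (dBdry Ω x) (ρ * e) ≤ Lf * (ρ * e) := by gcongr
          _ = (Lf * ρ) * e := by ring
          _ ≤ 1 / 4 * e := by gcongr
          _ = e / 4 := by ring) hT1 hT2 x (subset_closure hx) (min_le_left _ _)
    refine hcore.trans ?_
    have h2α : (1:ℝ) ≤ 2 ^ α := Real.one_le_rpow (by norm_num) hα0.le
    have : B * ρ / α ≤ 2 ^ α / α := by gcongr; linarith
    gcongr
  exact fun x hx => closure_induction_le (f := fun x => uε ε x - u x) (hUc.sub hu_cont) hmain x hx
end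
end

section
/- Let Ω ⊂ ℝⁿ be open and bounded with C² boundary, let p > 2, let λ > 0, and let f : cl(Ω) → ℝ be continuous, nonnegative, with compact support contained in Ω, and semiconcave in Ω (with some semiconcavity constant). Let u^ε ∈ C²(Ω) ∩ C(cl(Ω)) be the maximal solution of the state-constraint problem for λu + |Du|^p − εΔu = f (a classical solution in Ω, a viscosity supersolution on cl(Ω), satisfying liminf_{Ω∋x→x₀} (u^ε(x) − u^ε(x₀))/|x−x₀|^{α_p} < 0 for every x₀ ∈ ∂Ω), and let u ∈ C(cl(Ω)) be the state-constraint viscosity solution of λu + |Du|^p = f. Then there exists ε₀ > 0 such that for every ε ∈ (0, ε₀): max_{x ∈ cl(Ω)} (u^ε(x) − u(x)) ≤ (1/λ + 2^{α_p}/α_p)·ε^{1 − α_p/2}. -/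
open Set Metric Filter Topology Bornology MeasureTheory NNReal ENNReal

noncomputable section

lemma snd_test {h h' : ℝ → ℝ} {D : ℝ} (hmax : IsLocalMax h 0)
    (hd : ∀ᶠ t in 𝓝 (0:ℝ), HasDerivAt h (h' t) t) (h2 : HasDerivAt h' D 0) : D ≤ 0 := by
  by_contra hD
  push Not at hD
  have e1 : deriv h =ᶠ[𝓝 0] h' := hd.mono fun t ht => ht.deriv
  have e2 : deriv (deriv h) 0 = D := by rw [e1.deriv_eq]; exact h2.deriv
  have hmin : IsLocalMin h 0 :=
    isLocalMin_of_deriv_deriv_pos (by rw [e2]; exact hD) hmax.deriv_eq_zero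
      hd.self_of_nhds.continuousAt
  have hc : h =ᶠ[𝓝 0] fun _ => h 0 := by
    filter_upwards [hmax, hmin] with t h1 h2 using le_antisymm h1 h2
  have e3 : deriv h =ᶠ[𝓝 0] fun _ => 0 := by
    have := hc.deriv
    simpa using this
  have : deriv (deriv h) 0 = 0 := by rw [e3.deriv_eq]; simp
  linarith

lemma line_deriv1 {n : ℕ} {φ : EuclideanSpace ℝ (Fin n) → ℝ} {x₀ : EuclideanSpace ℝ (Fin n)}
    (h : ContDiffAt ℝ 2 φ x₀) (e : EuclideanSpace ℝ (Fin n)) :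
    ∀ᶠ t in 𝓝 (0:ℝ), HasDerivAt (fun t : ℝ => φ (x₀ + t • e)) (fderiv ℝ φ (x₀ + t • e) e) t := by
  have hc : Tendsto (fun t : ℝ => x₀ + t • e) (𝓝 0) (𝓝 x₀) := by
    have : Continuous (fun t : ℝ => x₀ + t • e) := by fun_prop
    simpa using this.tendsto 0
  have h1 : ∀ᶠ x in 𝓝 x₀, ContDiffAt ℝ 2 φ x := h.eventually (by simp)
  filter_upwards [hc.eventually h1] with t ht
  have hf : HasFDerivAt φ (fderiv ℝ φ (x₀ + t • e)) (x₀ + t • e) :=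
    (ht.differentiableAt (by norm_num)).hasFDerivAt
  have hl : HasDerivAt (fun t : ℝ => x₀ + t • e) e t := by
    simpa using ((hasDerivAt_id t).smul_const e).const_add x₀
  exact hf.comp_hasDerivAt t hl

lemma line_deriv2 {n : ℕ} {φ : EuclideanSpace ℝ (Fin n) → ℝ} {x₀ : EuclideanSpace ℝ (Fin n)}
    (h : ContDiffAt ℝ 2 φ x₀) (e : EuclideanSpace ℝ (Fin n)) :
    HasDerivAt (fun t : ℝ => fderiv ℝ φ (x₀ + t • e) e) (fderiv ℝ (fderiv ℝ φ) x₀ e e) 0 := by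
  have h1 : ContDiffAt ℝ 1 (fderiv ℝ φ) x₀ := h.fderiv_right (by norm_num)
  have h2 : HasFDerivAt (fderiv ℝ φ) (fderiv ℝ (fderiv ℝ φ) x₀) (x₀ + (0:ℝ) • e) := by
    simpa using (h1.differentiableAt (by norm_num)).hasFDerivAt
  have hl : HasDerivAt (fun t : ℝ => x₀ + t • e) e 0 := by
    simpa using ((hasDerivAt_id (0:ℝ)).smul_const e).const_add x₀
  have := (h2.comp_hasDerivAt 0 hl)
  simpa using this.clm_apply (hasDerivAt_const (0:ℝ) e)

/-- Interior second-order bound from semiconcavity. -/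
lemma lapl_le_of_semic {n : ℕ} {φ : EuclideanSpace ℝ (Fin n) → ℝ} {x₀ : EuclideanSpace ℝ (Fin n)}
    (h : ContDiffAt ℝ 2 φ x₀) {A : ℝ}
    (hA : ∀ᶠ v in 𝓝 (0 : EuclideanSpace ℝ (Fin n)),
      φ (x₀ + v) + φ (x₀ - v) - 2 * φ x₀ ≤ A * ‖v‖ ^ 2) :
    lapl φ x₀ ≤ n * A := by
  unfold lapl
  have key : ∀ i : Fin n, fderiv ℝ (fderiv ℝ φ) x₀ (EuclideanSpace.single i 1)
      (EuclideanSpace.single i 1) ≤ A := by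
    intro i
    set e : EuclideanSpace ℝ (Fin n) := EuclideanSpace.single i 1 with he
    have hne : ‖e‖ = 1 := by simp [he]
    have a1 := line_deriv1 h e
    have a2 := line_deriv2 h e
    have hneg : Tendsto (fun t : ℝ => -t) (𝓝 0) (𝓝 0) := by
      simpa using (continuous_neg (G := ℝ)).tendsto 0
    have b1 := hneg.eventually a1
    have := snd_test (h := fun t : ℝ => φ (x₀ + t • e) + φ (x₀ + (-t) • e) - A * t ^ 2)
      (h' := fun t => fderiv ℝ φ (x₀ + t • e) e + (fderiv ℝ φ (x₀ + (-t) • e) e) * (-1)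
        - A * (2 * t))
      (D := fderiv ℝ (fderiv ℝ φ) x₀ e e + (fderiv ℝ (fderiv ℝ φ) x₀ e e) * (-1) * (-1)
        - A * 2) ?_ ?_ ?_
    · linarith
    · have hc : Tendsto (fun t : ℝ => t • e) (𝓝 0) (𝓝 0) := by
        have : Continuous (fun t : ℝ => t • e) := by fun_prop
        simpa using this.tendsto 0
      filter_upwards [hc.eventually hA] with t ht
      rw [norm_smul, hne, mul_one, Real.norm_eq_abs, sq_abs] at ht
      simp only [zero_smul, neg_zero, add_zero, neg_smul]
      rw [sub_eq_add_neg x₀] at ht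
      nlinarith
    · filter_upwards [a1, b1] with t ht1 ht2
      have c2 := ht2.comp t (hasDerivAt_neg t)
      have c3 : HasDerivAt (fun t : ℝ => A * t ^ 2) (A * (2 * t)) t := by
        simpa using (hasDerivAt_pow 2 t).const_mul A
      exact (ht1.add c2).sub c3
    · have a2' : HasDerivAt (fun t : ℝ => fderiv ℝ φ (x₀ + t • e) e)
        (fderiv ℝ (fderiv ℝ φ) x₀ e e) (-(0:ℝ)) := by simpa using a2
      have c2 := (a2'.comp 0 (hasDerivAt_neg (0:ℝ))).mul_const (-1)
      have c3 : HasDerivAt (fun t : ℝ => A * (2 * t)) (A * 2) 0 := by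
        simpa using ((hasDerivAt_id (0:ℝ)).const_mul 2).const_mul A
      exact (a2.add c2).sub c3
  calc _ ≤ ∑ i : Fin n, A := Finset.sum_le_sum fun i _ => key i
    _ = n * A := by simp

/-- Comparison in a ball with a radial barrier of infinite boundary slope. -/
lemma ball_comp {n : ℕ} (z : EuclideanSpace ℝ (Fin n)) {s R lam p ε : ℝ} (hs : 0 < s) (hsR : s < R)
    (hlam : 0 < lam) (hε : 0 < ε)
    (φ : EuclideanSpace ℝ (Fin n) → ℝ) (hφ : ContDiffOn ℝ 2 φ (ball z R))
    (heq : ∀ x ∈ ball z R, lam * φ x + ‖gradient φ x‖ ^ p - ε * lapl φ x = 0)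
    (F : ℝ → ℝ) (hFc : ContinuousOn F (Ici 0))
    (hslope : ∀ C : ℝ, ∃ h₀ > 0, ∀ η, 0 < η → η < h₀ → F η < F 0 - C * η)
    (hF : ∀ η₀, 0 < η₀ → η₀ ≤ s / 2 → ∃ (G G' : ℝ → ℝ) (D : ℝ), G η₀ = F η₀ ∧
      (∀ᶠ η in 𝓝 η₀, F η ≤ G η) ∧ (∀ᶠ η in 𝓝 η₀, HasDerivAt G (G' η) η) ∧
      HasDerivAt G' D η₀ ∧
      ε * (D * (1 - 2 * η₀ / s) - G' η₀ * (n / s))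
        - (|G' η₀| * √(1 - 2 * η₀ / s)) ^ p ≤ lam * F η₀) :
    ∀ x ∈ closedBall z s, φ x ≤ F ((s ^ 2 - ‖x - z‖ ^ 2) / (2 * s)) := by
  set η : EuclideanSpace ℝ (Fin n) → ℝ := fun x => (s ^ 2 - ‖x - z‖ ^ 2) / (2 * s) with hη
  have hηc : Continuous η := by
    rw [hη]; fun_prop
  have hsub : closedBall z s ⊆ ball z R := closedBall_subset_ball hsR
  have hη0 : ∀ x ∈ closedBall z s, 0 ≤ η x := by
    intro x hx
    rw [mem_closedBall, dist_eq_norm] at hx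
    have : ‖x - z‖ ^ 2 ≤ s ^ 2 := by gcongr
    simp only [hη]
    apply div_nonneg <;> linarith
  have hcont : ContinuousOn (fun x => φ x - F (η x)) (closedBall z s) := by
    apply (hφ.continuousOn.mono hsub).sub
    exact hFc.comp hηc.continuousOn hη0
  obtain ⟨x₀, hx₀, hmax⟩ := (isCompact_closedBall z s).exists_isMaxOn
    ⟨z, mem_closedBall_self hs.le⟩ hcont
  suffices h : φ x₀ ≤ F (η x₀) by
    intro x hx
    have := hmax hx
    simp only [mem_ofPred_eq] at this
    linarith
  have hC2 : ContDiffAt ℝ 2 φ x₀ := hφ.contDiffAt (isOpen_ball.mem_nhds (hsub hx₀))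
  have hx₀s : ‖x₀ - z‖ ≤ s := by rwa [mem_closedBall, dist_eq_norm] at hx₀
  set a := x₀ - z with ha
  rcases hx₀s.eq_or_lt with hbd | hxint
  · -- boundary point: impossible
    exfalso
    have hd : HasFDerivAt φ (fderiv ℝ φ x₀) x₀ :=
      (hC2.differentiableAt (by norm_num)).hasFDerivAt
    have hl := (line_deriv1 hC2 (-a)).self_of_nhds
    set m : ℝ := fderiv ℝ φ (x₀ + (0:ℝ) • (-a)) (-a)
    have hlin := hl.isLittleO
    have h1 : ∀ᶠ t in 𝓝 (0:ℝ), φ (x₀ + t • (-a)) - φ x₀ ≥ - (|m| + 1) * |t| := by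
      have := hlin.def (c := 1) one_pos
      filter_upwards [this] with t ht
      simp only [zero_smul, add_zero, sub_zero, smul_eq_mul, Real.norm_eq_abs, one_mul] at ht
      have h2 := (abs_le.mp ht).1
      have h3 : - (|m| * |t|) ≤ t * m := by
        rw [← abs_mul, mul_comm m]; exact neg_abs_le _
      linarith
    obtain ⟨h₀, hh₀, hsl⟩ := hslope ((|m| + 1) * (2 / s))
    have hpos : ∀ᶠ t in 𝓝[>] (0:ℝ), φ (x₀ + t • (-a)) - φ x₀ ≥ - (|m| + 1) * |t| :=
      nhdsWithin_le_nhds h1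
    have hsm : ∀ᶠ t in 𝓝[>] (0:ℝ), t < min 1 (h₀ / s) := by
      apply nhdsWithin_le_nhds
      exact Iio_mem_nhds (lt_min one_pos (by positivity))
    obtain ⟨t, ⟨ht1, ht2⟩, ht0⟩ := ((hpos.and hsm).and self_mem_nhdsWithin).exists
    have ht0' : 0 < t := ht0
    have htl : t < 1 := ht2.trans_le (min_le_left _ _)
    have htr : t < h₀ / s := ht2.trans_le (min_le_right _ _)
    have hxt : x₀ + t • (-a) - z = (1 - t) • a := by
      rw [sub_smul, one_smul, smul_neg, ha]; abel
    have hnt : ‖x₀ + t • (-a) - z‖ = (1 - t) * s := by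
      rw [hxt, norm_smul, hbd, Real.norm_eq_abs, abs_of_pos (by linarith)]
    have hin : x₀ + t • (-a) ∈ closedBall z s := by
      rw [mem_closedBall, dist_eq_norm, hnt]; nlinarith
    have hm := hmax hin
    simp only [mem_ofPred_eq] at hm
    have e0 : η x₀ = 0 := by simp only [hη]; rw [← ha, hbd]; simp
    have e1 : η (x₀ + t • (-a)) = s * t * (1 - t / 2) := by
      simp only [hη]; rw [hnt]; field_simp; ring
    have p1 : 0 < s * t * (1 - t / 2) := by
      apply mul_pos (mul_pos hs ht0'); linarith
    have p2 : s * t * (1 - t / 2) < h₀ := by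
      rw [lt_div_iff₀ hs] at htr
      nlinarith [mul_pos hs ht0']
    have p3 := hsl _ p1 p2
    rw [e0, e1] at hm
    rw [abs_of_pos ht0'] at ht1
    have p4 : (|m| + 1) * t ≤ (|m| + 1) * (2 / s) * (s * t * (1 - t / 2)) := by
      have : (|m| + 1) * (2 / s) * (s * t * (1 - t / 2)) = (|m| + 1) * (t * (2 - t)) := by
        field_simp
      rw [this]
      apply mul_le_mul_of_nonneg_left _ (by positivity)
      nlinarith
    linarith
  · -- interior point
    have hη1 : 0 < η x₀ := by
      simp only [hη]; rw [← ha]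
      have : ‖a‖ ^ 2 < s ^ 2 := by gcongr
      apply div_pos <;> linarith
    have hη2 : η x₀ ≤ s / 2 := by
      simp only [hη]; rw [div_le_iff₀ (by positivity)]
      nlinarith [sq_nonneg ‖x₀ - z‖]
    obtain ⟨G, G', D, hG0, hFG, hG1, hG2, hineq⟩ := hF _ hη1 hη2
    have hτ : 1 - 2 * η x₀ / s = ‖a‖ ^ 2 / s ^ 2 := by
      simp only [hη]; rw [← ha]; field_simp; ring
    have hlm : IsLocalMax (fun x => φ x - G (η x)) x₀ := by
      have hnb : closedBall z s ∈ 𝓝 x₀ :=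
        Filter.mem_of_superset (isOpen_ball.mem_nhds (by rwa [mem_ball, dist_eq_norm]))
          ball_subset_closedBall
      filter_upwards [hnb, hηc.continuousAt.eventually hFG] with x hx1 hx2
      have := hmax hx1
      simp only [mem_ofPred_eq] at this
      linarith
    -- derivative of `η` along coordinate lines
    have hline : ∀ i : Fin n, ∀ t : ℝ, η (x₀ + t • EuclideanSpace.single i 1)
        = η x₀ - (t * a i / s + t ^ 2 / (2 * s)) := by
      intro i t
      simp only [hη]
      have : x₀ + t • EuclideanSpace.single i (1:ℝ) - z = a + t • EuclideanSpace.single i (1:ℝ) := by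
        rw [ha]; abel
      rw [this, ← ha, norm_add_sq_real, norm_smul, inner_smul_right, EuclideanSpace.inner_single_right]
      simp
      field_simp
      ring
    have hηd : ∀ i : Fin n, ∀ t : ℝ, HasDerivAt (fun t : ℝ => η (x₀ + t • EuclideanSpace.single i 1))
        (-(a i / s + t / s)) t := by
      intro i t
      simp only [hline i]
      have := ((((hasDerivAt_id t).mul_const (a i)).div_const s).add
        ((hasDerivAt_pow 2 t).div_const (2 * s))).const_sub (η x₀)
      refine this.congr_deriv ?_
      norm_num; field_simp
    have key : ∀ i : Fin n, fderiv ℝ φ x₀ (EuclideanSpace.single i 1) = - (G' (η x₀) * (a i / s)) ∧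
        fderiv ℝ (fderiv ℝ φ) x₀ (EuclideanSpace.single i 1) (EuclideanSpace.single i 1)
          ≤ D * (a i / s) ^ 2 - G' (η x₀) * (1 / s) := by
      intro i
      set e : EuclideanSpace ℝ (Fin n) := EuclideanSpace.single i 1 with he
      have hc0 : Tendsto (fun t : ℝ => x₀ + t • e) (𝓝 0) (𝓝 x₀) := by
        have : Continuous (fun t : ℝ => x₀ + t • e) := by fun_prop
        simpa using this.tendsto 0
      have hcη : Tendsto (fun t : ℝ => η (x₀ + t • e)) (𝓝 0) (𝓝 (η x₀)) :=
        (hηc.tendsto x₀).comp hc0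
      have hm0 : IsLocalMax (fun t : ℝ => φ (x₀ + t • e) - G (η (x₀ + t • e))) 0 := by
        filter_upwards [hc0.eventually hlm] with t ht
        simpa using ht
      have hd1 : ∀ᶠ t in 𝓝 (0:ℝ), HasDerivAt (fun t : ℝ => φ (x₀ + t • e) - G (η (x₀ + t • e)))
          (fderiv ℝ φ (x₀ + t • e) e - G' (η (x₀ + t • e)) * (-(a i / s + t / s))) t := by
        filter_upwards [line_deriv1 hC2 e, hcη.eventually hG1] with t ht1 ht2
        exact ht1.sub (HasDerivAt.comp t ht2 (hηd i t))
      have hd2 : HasDerivAt (fun t : ℝ =>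
          fderiv ℝ φ (x₀ + t • e) e - G' (η (x₀ + t • e)) * (-(a i / s + t / s)))
          (fderiv ℝ (fderiv ℝ φ) x₀ e e - (D * (-(a i / s + 0 / s)) * (-(a i / s + 0 / s))
            + G' (η (x₀ + (0:ℝ) • e)) * (-(1 / s)))) 0 := by
        have hG2' : HasDerivAt G' D (η (x₀ + (0:ℝ) • e)) := by simpa using hG2
        have q1 : HasDerivAt (fun t : ℝ => -(a i / s + t / s)) (-(1 / s)) 0 :=
          (((hasDerivAt_id (0:ℝ)).div_const s).const_add (a i / s)).neg
        exact (line_deriv2 hC2 e).sub ((HasDerivAt.comp (0:ℝ) hG2' (hηd i 0)).mul q1)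
      have r1 := hm0.hasDerivAt_eq_zero hd1.self_of_nhds
      have r2 := snd_test hm0 hd1 hd2
      simp only [zero_smul, add_zero, zero_div] at r1 r2
      constructor
      · linarith
      · nlinarith
    have hgrad : gradient φ x₀ = (-(G' (η x₀) / s)) • a := by
      ext i
      have h1 : inner ℝ (gradient φ x₀) (EuclideanSpace.single i (1:ℝ))
        = fderiv ℝ φ x₀ (EuclideanSpace.single i 1) := inner_gradient_left
      rw [(key i).1, EuclideanSpace.inner_single_right] at h1
      simp at h1
      simp [h1]
      ring
    have hng : ‖gradient φ x₀‖ = |G' (η x₀)| * √(1 - 2 * η x₀ / s) := by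
      rw [hgrad, norm_smul, hτ, Real.sqrt_div (by positivity), Real.sqrt_sq (norm_nonneg _),
        Real.sqrt_sq hs.le, Real.norm_eq_abs, abs_neg, abs_div, abs_of_pos hs]
      ring
    have hlap : lapl φ x₀ ≤ D * (1 - 2 * η x₀ / s) - G' (η x₀) * (n / s) := by
      unfold lapl
      calc _ ≤ ∑ i : Fin n, (D * (a i / s) ^ 2 - G' (η x₀) * (1 / s)) :=
            Finset.sum_le_sum fun i _ => (key i).2
        _ = _ := by
            rw [Finset.sum_sub_distrib, ← Finset.mul_sum, hτ, EuclideanSpace.norm_sq_eq,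
              Finset.sum_div]
            simp [div_pow]
            ring
    have e := heq x₀ (hsub hx₀)
    rw [hng] at e
    have := mul_le_mul_of_nonneg_left hlap hε.le
    have : lam * φ x₀ ≤ lam * F (η x₀) := by linarith
    exact le_of_mul_le_mul_left this hlam

/-- The one-dimensional boundary-layer profile. -/
lemma barrierW {α p : ℝ} (hα0 : 0 < α) (hα1 : α < 1) (hp : 2 < p) (hαp : (α - 1) * p = α - 2) :
    ∃ W : ℝ → ℝ, ContinuousOn W (Ici 0) ∧ W 0 ≤ 2 ^ α / α ∧ (∀ r, 0 ≤ r → W r ≤ W 0) ∧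
      (∀ r, 0 ≤ W r ∨ r < 0) ∧
      (∀ r, 0 ≤ r → r < 1 → W r = W 0 - r ^ α / α) ∧
      (∀ r₀, 0 < r₀ → ∃ (g g' : ℝ → ℝ) (D : ℝ), g r₀ = W r₀ ∧
        (∀ᶠ r in 𝓝 r₀, W r ≤ g r) ∧ (∀ᶠ r in 𝓝 r₀, HasDerivAt g (g' r) r) ∧
        HasDerivAt g' D r₀ ∧
        ∀ τ μ : ℝ, 0 ≤ τ → τ ≤ 1 → 0 ≤ μ → μ ≤ α / 4 → (r₀ ≤ 3 → 1 - α / 2 ≤ (√τ) ^ p) →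
          D * τ - g' r₀ * μ - (|g' r₀| * √τ) ^ p ≤ 1) := by
  set c : ℝ := 1 - α / 4 with hc
  have hc34 : 3 / 4 < c := by rw [hc]; linarith
  have hc0 : 0 < c := by linarith
  have hc1 : c < 1 := by rw [hc]; linarith
  set l : ℝ := 1 + 1 / c with hl
  have hcl : c * (l - 1) = 1 := by rw [hl]; field_simp; ring
  have hl1 : 1 < l := by nlinarith
  have hl3 : l ≤ 3 := by nlinarith
  set W0 : ℝ := 1 / α + 1 / (2 * c) with hW0
  set Q : ℝ → ℝ := fun r => W0 - r ^ α / α with hQ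
  set P : ℝ → ℝ := fun r => c / 2 * (l - r) ^ 2 with hP
  set W : ℝ → ℝ := fun r => if r ≤ 1 then Q r else c / 2 * (max (l - r) 0) ^ 2 with hW
  have hQ1 : Q 1 = 1 / (2 * c) := by simp [hQ, hW0]
  have hP1 : P 1 = 1 / (2 * c) := by
    simp only [hP]; rw [hl]; field_simp; ring
  have hQc : Continuous Q := by
    rw [hQ]
    exact continuous_const.sub ((Real.continuous_rpow_const hα0.le).div_const _)
  have hWc : Continuous W := by
    rw [hW]
    refine Continuous.if_le hQc (by fun_prop) continuous_id continuous_const ?_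
    intro x hx
    have hx : x = 1 := hx
    rw [hx, hQ1, max_eq_left (by linarith), ← hP1]
  have hW00 : W 0 = W0 := by
    simp [hW, hQ, Real.zero_rpow hα0.ne']
  have hPW : ∀ r, 1 < r → W r ≤ P r := by
    intro r hr
    simp only [hW, hP, if_neg (not_le.mpr hr)]
    apply mul_le_mul_of_nonneg_left _ (by positivity)
    rcases le_total (l - r) 0 with h | h
    · rw [max_eq_right h]; nlinarith [sq_nonneg (l - r)]
    · rw [max_eq_left h]
  have hQd : ∀ r : ℝ, 0 < r → HasDerivAt Q (-(r ^ (α - 1))) r := by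
    intro r hr
    have := ((Real.hasDerivAt_rpow_const (p := α) (Or.inl hr.ne')).div_const α).const_sub W0
    refine this.congr_deriv ?_
    field_simp
  have hQd2 : ∀ r : ℝ, 0 < r → HasDerivAt (fun r : ℝ => -(r ^ (α - 1)))
      (-((α - 1) * r ^ (α - 2))) r := by
    intro r hr
    have := (Real.hasDerivAt_rpow_const (p := α - 1) (Or.inl hr.ne')).neg
    refine this.congr_deriv ?_
    rw [show α - 1 - 1 = α - 2 by ring]
  have hPd : ∀ r : ℝ, HasDerivAt P (-(c * (l - r))) r := by
    intro r
    have := (((hasDerivAt_id r).const_sub l).pow 2).const_mul (c / 2)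
    refine this.congr_deriv ?_
    simp; ring
  have hPd2 : ∀ r : ℝ, HasDerivAt (fun r : ℝ => -(c * (l - r))) c r := by
    intro r
    have := (((hasDerivAt_id r).const_sub l).const_mul c).neg
    refine this.congr_deriv ?_
    simp
  refine ⟨W, hWc.continuousOn, ?_, ?_, ?_, ?_, ?_⟩
  · rw [hW00, hW0]
    have h2 : 1 + α * Real.log 2 ≤ (2:ℝ) ^ α := by
      rw [Real.rpow_def_of_pos (by norm_num)]
      have := Real.add_one_le_exp (Real.log 2 * α)
      linarith
    have hlog := Real.log_two_gt_d9
    have h3 : 1 / (2 * c) ≤ Real.log 2 := by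
      rw [div_le_iff₀ (by positivity)]; nlinarith
    rw [le_div_iff₀ hα0, add_mul, div_mul_cancel₀ _ hα0.ne']
    nlinarith
  · intro r hr
    rw [hW00]
    by_cases h : r ≤ 1
    · simp only [hW, if_pos h, hQ]
      have := Real.rpow_nonneg hr α
      have : 0 ≤ r ^ α / α := by positivity
      linarith
    · simp only [hW, if_neg h]
      push Not at h
      have h4 : max (l - r) 0 ≤ l - 1 := max_le (by linarith) (by linarith)
      have h5 : (max (l - r) 0) ^ 2 ≤ (l - 1) ^ 2 := by gcongr
      have h6 : c / 2 * (l - 1) ^ 2 = 1 / (2 * c) := hP1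
      have h7 : 0 < 1 / α := by positivity
      nlinarith
  · intro r
    by_cases hr : r < 0
    · right; exact hr
    left
    push Not at hr
    by_cases h : r ≤ 1
    · simp only [hW, if_pos h, hQ, hW0]
      have h1 : r ^ α ≤ 1 := Real.rpow_le_one hr h hα0.le
      have : r ^ α / α ≤ 1 / α := by gcongr
      have h2 : 0 < 1 / (2 * c) := by positivity
      linarith
    · simp only [hW, if_neg h]; positivity
  · intro r _ hr
    rw [hW00]
    simp only [hW, if_pos hr.le, hQ]
  · intro r₀ hr₀
    rcases lt_or_ge r₀ 1 with h1 | h1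
    · refine ⟨Q, fun r => -(r ^ (α - 1)), -((α - 1) * r₀ ^ (α - 2)), ?_, ?_, ?_, hQd2 r₀ hr₀, ?_⟩
      · simp [hW, if_pos h1.le]
      · filter_upwards [Iio_mem_nhds h1] with r hr
        have hr : r < 1 := hr
        simp only [hW, if_pos hr.le]; exact le_rfl
      · filter_upwards [Ioi_mem_nhds hr₀] with r hr using hQd r hr
      · intro τ μ hτ0 hτ1 hμ0 hμ1 hs
        have hs := hs (by linarith)
        have hρ : 0 < r₀ ^ (α - 2) := Real.rpow_pos_of_pos hr₀ _
        have hx : 0 < r₀ ^ (α - 1) := Real.rpow_pos_of_pos hr₀ _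
        have e1 : r₀ ^ (α - 1) = r₀ ^ (α - 2) * r₀ := by
          rw [← Real.rpow_add_one hr₀.ne']; congr 1; ring
        have e2 : (|-(r₀ ^ (α - 1))| * √τ) ^ p = r₀ ^ (α - 2) * (√τ) ^ p := by
          rw [abs_neg, abs_of_pos hx, Real.mul_rpow hx.le (Real.sqrt_nonneg _),
            ← Real.rpow_mul hr₀.le, hαp]
        beta_reduce
        rw [e2, e1]
        set ρ := r₀ ^ (α - 2)
        have a1 : ρ * τ * (1 - α) ≤ ρ * (1 - α) := by
          have := mul_le_mul_of_nonneg_left hτ1 hρ.le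
          nlinarith
        have a2 : ρ * r₀ * μ ≤ ρ * (α / 4) := by
          have : r₀ * μ ≤ 1 * (α / 4) := by gcongr
          nlinarith
        have a3 := mul_le_mul_of_nonneg_left hs hρ.le
        nlinarith
    · rcases le_or_gt r₀ l with h2 | h2
      · refine ⟨P, fun r => -(c * (l - r)), c, ?_, ?_, ?_, hPd2 r₀, ?_⟩
        · rcases h1.eq_or_lt with h | h
          · rw [← h, hP1]; simp [hW, hQ1]
          · simp [hW, if_neg (not_le.mpr h), hP, h2]
        · rcases h1.eq_or_lt with h | h
          · rw [← h]
            have hd : deriv (fun r => P r - Q r) =ᶠ[𝓝 1]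
                fun r => -(c * (l - r)) - -(r ^ (α - 1)) := by
              filter_upwards [Ioi_mem_nhds (zero_lt_one (α := ℝ))] with r hr
              exact ((hPd r).sub (hQd r hr)).deriv
            have hm : IsLocalMin (fun r => P r - Q r) 1 := by
              apply isLocalMin_of_deriv_deriv_pos
              · have h3 := ((hPd2 1).sub (hQd2 1 one_pos)).deriv
                have h4 : deriv (fun r => -(c * (l - r)) - -(r ^ (α - 1))) 1
                    = c - -((α - 1) * 1 ^ (α - 2)) := h3
                rw [hd.deriv_eq, h4]
                simp; linarith
              · rw [hd.self_of_nhds]; simp; linarith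
              · exact ((hPd 1).sub (hQd 1 one_pos)).continuousAt
            filter_upwards [hm] with r hr
            rw [hP1, hQ1] at hr
            by_cases hr1 : r ≤ 1
            · simp only [hW, if_pos hr1]; linarith
            · exact hPW r (not_le.mp hr1)
          · filter_upwards [Ioi_mem_nhds h] with r hr using hPW r hr
        · exact Eventually.of_forall hPd
        · intro τ μ hτ0 hτ1 hμ0 hμ1 _
          have b1 : 0 ≤ (|-(c * (l - r₀))| * √τ) ^ p := by positivity
          have b2 : c * (l - r₀) ≤ 1 := by nlinarith
          have b3 : c * (l - r₀) * μ ≤ 1 * μ := by gcongr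
          have b4 : c * τ ≤ c := by nlinarith
          linarith
      · refine ⟨fun _ => 0, fun _ => 0, 0, ?_, ?_, ?_, hasDerivAt_const _ _, ?_⟩
        · simp only [hW, if_neg (not_le.mpr (hl1.trans h2))]
          rw [max_eq_right (by linarith)]; simp
        · filter_upwards [Ioi_mem_nhds h2] with r hr
          have hr : l < r := hr
          simp only [hW, if_neg (not_le.mpr (hl1.trans hr))]
          rw [max_eq_right (by linarith)]; simp
        · exact Eventually.of_forall fun r => hasDerivAt_const _ _
        · intro τ μ _ _ _ _ _
          simp [Real.zero_rpow (by linarith : p ≠ 0)]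

/-- Bound for solutions of the homogeneous equation in a ball. -/
lemma ball_bound {n : ℕ} (z : EuclideanSpace ℝ (Fin n)) {R lam p ε α : ℝ} (hR : 0 < R)
    (hlam : 0 < lam) (hε : 0 < ε) (hα0 : 0 < α) (hα1 : α < 1) (hp : 2 < p)
    (hαp : (α - 1) * p = α - 2)
    (h1 : √ε * (n * 2 / R) ≤ α / 4) (h2 : 6 * p * √ε / R ≤ α / 2)
    (φ : EuclideanSpace ℝ (Fin n) → ℝ) (hφ : ContDiffOn ℝ 2 φ (ball z R))
    (heq : ∀ x ∈ ball z R, lam * φ x + ‖gradient φ x‖ ^ p - ε * lapl φ x = 0) :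
    ∀ x ∈ ball z R, φ x ≤ (1 / lam + 2 ^ α / α) * ε ^ (1 - α / 2) := by
  obtain ⟨W, hWc, hW0, hWle, hWnn, hWs, hWt⟩ := barrierW hα0 hα1 hp hαp
  intro x hx
  rw [mem_ball, dist_eq_norm] at hx
  obtain ⟨s, hs1, hs2⟩ := exists_between (max_lt hx (half_lt_self hR))
  have hxs : ‖x - z‖ < s := (le_max_left _ _).trans_lt hs1
  have hsR : R / 2 < s := (le_max_right _ _).trans_lt hs1
  have hs : 0 < s := by linarith
  set q := √ε with hq
  have hq0 : 0 < q := Real.sqrt_pos.mpr hε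
  have hqq : q * q = ε := Real.mul_self_sqrt hε.le
  set K := ε ^ (1 - α / 2) with hK
  have hK0 : 0 < K := Real.rpow_pos_of_pos hε _
  have hKq : (K / q) ^ p = K := by
    have : K / q = ε ^ ((1 - α) / 2) := by
      rw [hK, hq, Real.sqrt_eq_rpow, ← Real.rpow_sub hε]; congr 1; ring
    rw [this, ← Real.rpow_mul hε.le, hK]
    congr 1
    linarith
  set F : ℝ → ℝ := fun η => K * (1 / lam + W (η / q)) with hF
  have main := ball_comp (p := p) z hs hs2 hlam hε φ hφ heq F ?_ ?_ ?_ x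
    (by rw [mem_closedBall, dist_eq_norm]; exact hxs.le)
  · have hη : 0 ≤ (s ^ 2 - ‖x - z‖ ^ 2) / (2 * s) := by
      have : ‖x - z‖ ^ 2 ≤ s ^ 2 := by gcongr
      apply div_nonneg <;> linarith
    refine main.trans ?_
    have := hWle _ (div_nonneg hη hq0.le)
    simp only [hF]
    rw [mul_comm K]
    gcongr
    linarith
  · apply ContinuousOn.mul continuousOn_const
    apply ContinuousOn.add continuousOn_const
    apply hWc.comp (by fun_prop)
    intro η hη
    exact div_nonneg hη hq0.le
  · intro C
    have hlim : Tendsto (fun r : ℝ => r ^ (α - 1)) (𝓝[>] 0) atTop :=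
      tendsto_rpow_neg_nhdsGT_zero (by linarith)
    have hev : ∀ᶠ r in 𝓝[>] (0:ℝ), α * (C * q / K) < r ^ (α - 1) := hlim.eventually_gt_atTop _
    rw [eventually_nhdsWithin_iff, Metric.eventually_nhds_iff] at hev
    obtain ⟨δ, hδ, hev⟩ := hev
    refine ⟨min δ 1 * q, by positivity, ?_⟩
    intro η hη0 hη1
    have hr0 : 0 < η / q := by positivity
    have hr1 : η / q < min δ 1 := by rwa [div_lt_iff₀ hq0]
    have hrδ := hr1.trans_le (min_le_left _ _)
    have hr1' := hr1.trans_le (min_le_right _ _)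
    have h3 := hev (y := η / q) (by rw [dist_zero_right, Real.norm_eq_abs, abs_of_pos hr0]; exact hrδ) hr0
    simp only [hF]
    rw [zero_div, hWs _ hr0.le hr1']
    set r := η / q with hr
    have hηr : η = r * q := by rw [hr]; field_simp
    have e1 : r ^ α = r ^ (α - 1) * r := by
      rw [← Real.rpow_add_one hr0.ne']; congr 1; ring
    have h4 : C * η < K * (r ^ α / α) := by
      rw [e1, hηr]
      have : α * (C * q / K) * (r * K / α) < r ^ (α - 1) * (r * K / α) := by gcongr
      have e2 : α * (C * q / K) * (r * K / α) = C * (r * q) := by field_simp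
      have e3 : r ^ (α - 1) * (r * K / α) = K * (r ^ (α - 1) * r / α) := by ring
      rwa [e2, e3] at this
    linarith
  · intro η₀ hη0 hη2
    have hr0 : 0 < η₀ / q := by positivity
    obtain ⟨g, g', D, hg0, hgW, hg1, hg2, hin⟩ := hWt (η₀ / q) hr0
    have hct : Tendsto (fun η : ℝ => η / q) (𝓝 η₀) (𝓝 (η₀ / q)) :=
      (continuous_id.div_const q).tendsto η₀
    have hdq : ∀ η : ℝ, HasDerivAt (fun η : ℝ => η / q) (1 / q) η := fun η =>
      (hasDerivAt_id η).div_const q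
    refine ⟨fun η => K * (1 / lam + g (η / q)), fun η => K * (g' (η / q) * (1 / q)),
      K * (D * (1 / q) * (1 / q)), ?_, ?_, ?_, ?_, ?_⟩
    · simp only [hF, hg0]
    · filter_upwards [hct.eventually hgW] with η hη
      simp only [hF]; gcongr
    · filter_upwards [hct.eventually hg1] with η hη
      exact ((HasDerivAt.comp η hη (hdq η)).const_add (1 / lam)).const_mul K
    · exact ((HasDerivAt.comp η₀ hg2 (hdq η₀)).mul_const (1 / q)).const_mul K
    · set τ := 1 - 2 * η₀ / s with hτ
      have t0 : 0 ≤ τ := by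
        rw [hτ, sub_nonneg, div_le_one hs]; linarith
      have t1 : τ ≤ 1 := by
        rw [hτ]; have : 0 ≤ 2 * η₀ / s := by positivity
        linarith
      have hμ : q * (n / s) ≤ α / 4 := by
        refine le_trans ?_ h1
        have : (n:ℝ) / s ≤ n * 2 / R := by
          rw [div_le_div_iff₀ hs hR]
          have : (0:ℝ) ≤ n := by positivity
          nlinarith
        gcongr
      have hcond : η₀ / q ≤ 3 → 1 - α / 2 ≤ (√τ) ^ p := by
        intro h3
        rw [div_le_iff₀ hq0] at h3
        have e1 : (√τ) ^ p = τ ^ (p / 2) := by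
          rw [Real.sqrt_eq_rpow, ← Real.rpow_mul t0]; congr 1; ring
        have hb := one_add_mul_self_le_rpow_one_add (s := -(2 * η₀ / s)) (by linarith)
          (p := p / 2) (by linarith)
        rw [e1, hτ, sub_eq_add_neg (1:ℝ) (2 * η₀ / s)]
        refine le_trans ?_ hb
        have h5 : p / 2 * (2 * η₀ / s) ≤ 6 * p * q / R := by
          have : p / 2 * (2 * η₀ / s) = p * η₀ / s := by ring
          rw [this, div_le_div_iff₀ hs hR]
          have i1 : p * η₀ * R ≤ p * (3 * q) * R := by gcongr
          have i2 : p * (3 * q) * R ≤ p * (3 * q) * (2 * s) := by gcongr; linarith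
          linarith
        linarith
      have hfin := hin τ (q * (n / s)) t0 t1 (by positivity) hμ hcond
      have e1 : (|K * (g' (η₀ / q) * (1 / q))| * √τ) ^ p = K * (|g' (η₀ / q)| * √τ) ^ p := by
        have : |K * (g' (η₀ / q) * (1 / q))| * √τ = (K / q) * (|g' (η₀ / q)| * √τ) := by
          rw [abs_mul, abs_mul, abs_of_pos hK0, abs_of_pos (by positivity : 0 < 1 / q)]; ring
        rw [this, Real.mul_rpow (by positivity) (by positivity), hKq]
      beta_reduce
      rw [e1]
      have e2 : ε * (K * (D * (1 / q) * (1 / q)) * τ - K * (g' (η₀ / q) * (1 / q)) * (n / s))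
          = K * (D * τ - g' (η₀ / q) * (q * (n / s))) := by
        rw [← hqq]; field_simp
      rw [e2]
      have e3 := mul_le_mul_of_nonneg_left hfin hK0.le
      have e4 : K ≤ lam * F η₀ := by
        simp only [hF]
        have hw : 0 ≤ W (η₀ / q) := by
          rcases hWnn (η₀ / q) with h | h
          · exact h
          · linarith
        have : lam * (K * (1 / lam + W (η₀ / q))) = K + lam * K * W (η₀ / q) := by field_simp
        rw [this]
        have : 0 ≤ lam * K * W (η₀ / q) := by positivity
        linarith
      linarith

lemma int_ball_aux {n : ℕ} {Ω : Set (EuclideanSpace ℝ (Fin n))} (hΩo : IsOpen Ω)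
    (hΩb : IsBounded Ω) (hne : (frontier Ω).Nonempty) {R : ℝ}
    (hd : ∀ z ∈ Ω, dBdry Ω z < R → DifferentiableAt ℝ (dBdry Ω) z)
    {x : EuclideanSpace ℝ (Fin n)} (hx : x ∈ Ω) (hxR : dBdry Ω x < R) :
    ∃ z ∈ Ω, dBdry Ω z = R ∧ x ∈ ball z R := by
  have hcl : IsClosed (frontier Ω) := isClosed_frontier
  have hcΩ : IsCompact (closure Ω) := hΩb.isCompact_closure
  have hcF : IsCompact (frontier Ω) := hcΩ.of_isClosed_subset hcl frontier_subset_closure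
  have hdc : Continuous (dBdry Ω) := continuous_infDist_pt _
  have hnotF : ∀ z ∈ Ω, z ∉ frontier Ω := by
    intro z hz hzF
    rw [hΩo.frontier_eq] at hzF
    exact hzF.2 hz
  have hpos : ∀ z ∈ Ω, 0 < dBdry Ω z := by
    intro z hz
    exact (hcl.notMem_iff_infDist_pos hne).1 (hnotF z hz)
  have hzero : ∀ z ∈ closure Ω, 0 < dBdry Ω z → z ∈ Ω := by
    intro z hz hp
    by_contra hzΩ
    have : z ∈ frontier Ω := by rw [hΩo.frontier_eq]; exact ⟨hz, hzΩ⟩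
    have : dBdry Ω z = 0 := infDist_zero_of_mem this
    linarith
  set t := dBdry Ω x with ht
  have htp : 0 < t := hpos x hx
  have hR : 0 < R := by linarith
  -- σ with (R-t)/σ < R
  obtain ⟨σ, hσ1, hσ2⟩ : ∃ σ, (R - t) / R < σ ∧ σ < 1 :=
    exists_between (by rw [div_lt_one hR]; linarith)
  have hσ0 : 0 < σ := lt_of_le_of_lt (div_nonneg (by linarith) hR.le) hσ1
  have hσR : R - t < σ * R := by rwa [div_lt_iff₀ hR] at hσ1
  set S := closure Ω ∩ {z | dBdry Ω z ≤ R} with hS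
  have hSc : IsCompact S := hcΩ.inter_right (isClosed_le hdc continuous_const)
  have hxS : x ∈ S := ⟨subset_closure hx, hxR.le⟩
  obtain ⟨z, hzS, hzmax⟩ := hSc.exists_isMaxOn ⟨x, hxS⟩
    (f := fun z => dBdry Ω z - σ * ‖z - x‖) (by fun_prop)
  have hmx := hzmax hxS
  simp only [mem_ofPred_eq, sub_self, norm_zero, mul_zero, sub_zero] at hmx
  have hdz : t ≤ dBdry Ω z := by
    have := mul_nonneg hσ0.le (norm_nonneg (z - x)); linarith
  have hzΩ : z ∈ Ω := hzero z hzS.1 (by linarith)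
  have hzR : dBdry Ω z = R := by
    by_contra hne'
    have hlt : dBdry Ω z < R := lt_of_le_of_ne hzS.2 hne'
    obtain ⟨y, hyF, hy⟩ := hcF.exists_infDist_eq_dist hne z
    have hzy : dBdry Ω z = ‖y - z‖ := by rw [dBdry, hy, dist_comm, dist_eq_norm]
    set D := ‖y - z‖ with hD
    have hDp : 0 < D := by rw [← hzy]; linarith
    set e := D⁻¹ • (y - z) with he
    have hen : ‖e‖ = 1 := by rw [he, norm_smul, norm_inv, Real.norm_of_nonneg hDp.le, ← hD]; field_simp
    have hye : y = z + D • e := by rw [he, smul_inv_smul₀ hDp.ne']; abel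
    have hdiff := hd z hzΩ hlt
    have hl : HasDerivAt (fun s : ℝ => z - s • e) (-e) 0 := by
      simpa using ((hasDerivAt_id (0:ℝ)).smul_const e).const_sub z
    have hder : HasDerivAt (fun s : ℝ => dBdry Ω (z - s • e)) (fderiv ℝ (dBdry Ω) z (-e)) 0 := by
      have h2 : HasFDerivAt (dBdry Ω) (fderiv ℝ (dBdry Ω) z) (z - (0:ℝ) • e) := by
        simpa using hdiff.hasFDerivAt
      exact h2.comp_hasDerivAt 0 hl
    set m := fderiv ℝ (dBdry Ω) z (-e)
    have hsl := hasDerivAt_iff_tendsto_slope.1 hder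
    have h1 : 1 ≤ m := by
      have hsl' : Tendsto (slope (fun s : ℝ => dBdry Ω (z - s • e)) 0) (𝓝[<] 0) (𝓝 m) :=
        hsl.mono_left (nhdsWithin_mono _ (fun s hs => ne_of_lt hs))
      refine ge_of_tendsto hsl' ?_
      have : ∀ᶠ s in 𝓝[<] (0:ℝ), s ∈ Ioo (-D) 0 := Ioo_mem_nhdsLT (by linarith)
      filter_upwards [this] with s hs
      rw [slope_def_field, le_div_iff_of_neg (by linarith [hs.2])]
      have : dBdry Ω (z - s • e) ≤ D + s := by
        refine (infDist_le_dist_of_mem hyF).trans ?_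
        have : z - s • e - y = -((s + D) • e) := by rw [hye]; module
        rw [dist_eq_norm, this, norm_neg, norm_smul, hen, Real.norm_of_nonneg (by linarith [hs.1])]
        linarith
      simp only [zero_smul, sub_zero]
      linarith
    have h2 : m ≤ σ := by
      have hsl' : Tendsto (slope (fun s : ℝ => dBdry Ω (z - s • e)) 0) (𝓝[>] 0) (𝓝 m) :=
        hsl.mono_left (nhdsWithin_mono _ (fun s hs => ne_of_gt hs))
      refine le_of_tendsto hsl' ?_
      have hcont : Tendsto (fun s : ℝ => z - s • e) (𝓝 0) (𝓝 z) := by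
        simpa using hl.continuousAt.tendsto
      have hnb : ∀ᶠ w in 𝓝 z, w ∈ Ω ∧ dBdry Ω w < R :=
        (hΩo.eventually_mem hzΩ).and ((hdc.tendsto z).eventually (gt_mem_nhds hlt) )
      have := (hcont.eventually hnb).filter_mono (nhdsWithin_le_nhds (s := Ioi 0))
      filter_upwards [this, self_mem_nhdsWithin] with s hs hs0
      have hs0 : 0 < s := hs0
      rw [slope_def_field, div_le_iff₀ (by linarith)]
      have hm := hzmax (show z - s • e ∈ S from ⟨subset_closure hs.1, hs.2.le⟩)
      simp only [mem_ofPred_eq] at hm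
      have hn : ‖z - s • e - x‖ ≤ ‖z - x‖ + s := by
        have : z - s • e - x = (z - x) - s • e := by abel
        rw [this]
        refine (norm_sub_le _ _).trans ?_
        rw [norm_smul, hen, Real.norm_of_nonneg hs0.le]; simp
      have := mul_le_mul_of_nonneg_left hn hσ0.le
      simp only [zero_smul, sub_zero]
      linarith
    linarith
  refine ⟨z, hzΩ, hzR, ?_⟩
  rw [mem_ball, dist_comm, dist_eq_norm]
  have : σ * ‖z - x‖ < σ * R := by rw [hzR] at hmx; linarith
  exact lt_of_mul_lt_mul_left this hσ0.le

lemma int_ball {n : ℕ} {Ω K : Set (EuclideanSpace ℝ (Fin n))} (hΩo : IsOpen Ω)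
    (hΩb : IsBounded Ω) (hΩne : Ω.Nonempty) (hC2 : 0 < deltaOm Ω) (hK : IsCompact K) (hKΩ : K ⊆ Ω) :
    ∃ R > 0, (frontier Ω).Nonempty ∧ ∀ x ∈ Ω, dBdry Ω x < R → ∃ z, x ∈ ball z R ∧ ball z R ⊆ Ω ∧
      ∀ w ∈ ball z R, w ∉ K := by
  have hset : ({δ : ℝ | 0 < δ ∧ δ < sSup (dBdry Ω '' Ω) ∧
    ContDiffOn ℝ 2 (dBdry Ω) {x ∈ Ω | dBdry Ω x ≤ δ}}).Nonempty := by
    by_contra h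
    rw [not_nonempty_iff_eq_empty] at h
    rw [deltaOm, h, Real.sSup_empty] at hC2
    simp at hC2
  obtain ⟨δ, hδ, hδs, hδC⟩ := hset
  have hne : (frontier Ω).Nonempty := by
    by_contra h
    rw [not_nonempty_iff_eq_empty] at h
    have h0 : dBdry Ω = fun _ => 0 := by
      funext x; rw [dBdry, h, infDist_empty]
    rw [h0, hΩne.image_const, csSup_singleton] at hδs
    linarith
  have hdc : Continuous (dBdry Ω) := continuous_infDist_pt _
  obtain ⟨ρ, hρ, hρs⟩ := hK.exists_cthickening_subset_open hΩo hKΩ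
  refine ⟨min δ (ρ / 2), lt_min hδ (by linarith), hne, ?_⟩
  set R := min δ (ρ / 2) with hRdef
  have hRδ : R ≤ δ := min_le_left _ _
  have hRρ : R ≤ ρ / 2 := min_le_right _ _
  have hRpos : 0 < R := lt_min hδ (by linarith)
  intro x hx hxR
  obtain ⟨z, hzΩ, hzR, hxz⟩ := int_ball_aux hΩo hΩb hne (R := R) (by
    intro z hz hzR
    have hmem : {x ∈ Ω | dBdry Ω x ≤ δ} ∈ 𝓝 z := by
      filter_upwards [hΩo.mem_nhds hz, (hdc.tendsto z).eventually (gt_mem_nhds (lt_of_lt_of_le hzR hRδ))]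
        with w h1 h2 using ⟨h1, le_of_lt h2⟩
    exact (hδC.contDiffAt hmem).differentiableAt (by norm_num)) hx hxR
  have hdisj : ∀ w ∈ ball z R, w ∉ frontier Ω := by
    intro w hw hwF
    have := infDist_le_dist_of_mem (x := z) hwF
    rw [dBdry] at hzR
    rw [hzR, dist_comm] at this
    exact absurd (mem_ball.1 hw) (not_lt.2 this)
  have hsub : ball z R ⊆ Ω := by
    have hpc : IsPreconnected (ball z R) := (convex_ball z R).isPreconnected
    refine hpc.subset_left_of_subset_union hΩo isClosed_closure.isOpen_compl
      (disjoint_compl_right.mono_left subset_closure) ?_ ⟨z, mem_ball_self hRpos, hzΩ⟩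
    intro w hw
    by_cases h : w ∈ closure Ω
    · left
      by_contra h2
      exact hdisj w hw (by rw [hΩo.frontier_eq]; exact ⟨h, h2⟩)
    · right; exact h
  refine ⟨z, hxz, hsub, ?_⟩
  intro w hw hwK
  obtain ⟨y, hyF, hy⟩ := (hΩb.isCompact_closure.of_isClosed_subset isClosed_frontier
    frontier_subset_closure).exists_infDist_eq_dist hne z
  have hzy : dist z y = R := by rw [← hy]; exact hzR
  have hwy : dist y w ≤ ρ := by
    have := dist_triangle y z w
    rw [dist_comm y z, dist_comm z w] at this
    have := mem_ball.1 hw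
    linarith
  have : y ∈ Ω := hρs (mem_cthickening_of_dist_le y w ρ K hwK hwy)
  rw [hΩo.frontier_eq] at hyF
  exact hyF.2 this

lemma hasGrad_quad {n : ℕ} (A N : ℝ) (a b w : EuclideanSpace ℝ (Fin n)) :
    gradient (fun w => A * ‖w - a‖ ^ 2 + N * ‖w + b‖ ^ 2) w
      = (2 * A) • (w - a) + (2 * N) • (w + b) := by
  apply HasGradientAt.gradient
  rw [hasGradientAt_iff_hasFDerivAt]
  have h1 : HasFDerivAt (fun w => w - a) (ContinuousLinearMap.id ℝ (EuclideanSpace ℝ (Fin n))) w :=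
    (hasFDerivAt_id w).sub_const a
  have h2 : HasFDerivAt (fun w => w + b) (ContinuousLinearMap.id ℝ (EuclideanSpace ℝ (Fin n))) w :=
    (hasFDerivAt_id w).add_const b
  have := (h1.norm_sq.const_mul A).add (h2.norm_sq.const_mul N)
  refine this.congr_fderiv ?_
  ext v
  simp [inner_add_left, inner_smul_left, inner_sub_left]
  ring

lemma contDiff_quad {n : ℕ} (A N : ℝ) (a b : EuclideanSpace ℝ (Fin n)) :
    ContDiff ℝ 1 (fun w => A * ‖w - a‖ ^ 2 + N * ‖w + b‖ ^ 2) := by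
  have h1 : ContDiff ℝ 1 (fun w : EuclideanSpace ℝ (Fin n) => ‖w - a‖ ^ 2) :=
    (contDiff_id.sub contDiff_const).norm_sq ℝ
  have h2 : ContDiff ℝ 1 (fun w : EuclideanSpace ℝ (Fin n) => ‖w + b‖ ^ 2) :=
    (contDiff_id.add contDiff_const).norm_sq ℝ
  exact (contDiff_const.mul h1).add (contDiff_const.mul h2)

lemma norm_rpow_mid {n : ℕ} {p : ℝ} (hp : 1 ≤ p) (a b : EuclideanSpace ℝ (Fin n)) :
    2 * ‖(1/2 : ℝ) • (a + b)‖ ^ p ≤ ‖a‖ ^ p + ‖b‖ ^ p := by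
  have h := (convexOn_rpow hp).2 (norm_nonneg a) (norm_nonneg b)
    (by norm_num : (0:ℝ) ≤ 1/2) (by norm_num : (0:ℝ) ≤ 1/2) (by norm_num)
  simp only [smul_eq_mul] at h
  have h2 : ‖(1/2 : ℝ) • (a + b)‖ ≤ 1/2 * ‖a‖ + 1/2 * ‖b‖ := by
    rw [norm_smul]
    have := norm_add_le a b
    norm_num
    linarith
  have h3 := Real.rpow_le_rpow (norm_nonneg _) h2 (by linarith : 0 ≤ p)
  linarith

lemma semic_global {n : ℕ} {U f : EuclideanSpace ℝ (Fin n) → ℝ} {K : Set (EuclideanSpace ℝ (Fin n))}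
    (hK : IsCompact K) (hU : Continuous U) (hf : Continuous f) (hU0 : ∀ x, 0 ≤ U x)
    (hf0 : ∀ x, 0 ≤ f x) (hUK : ∀ x ∉ K, U x = 0) (hfK : ∀ x ∉ K, f x = 0)
    {lam p c : ℝ} (hlam : 0 < lam) (hp : 2 < p) (hc : 0 < c)
    (hsub : ∀ x φ, ContDiff ℝ 1 φ → IsLocalMax (fun y => U y - φ y) x →
      lam * U x + ‖gradient φ x‖ ^ p ≤ f x)
    (hsup : ∀ x φ, ContDiff ℝ 1 φ → IsLocalMin (fun y => U y - φ y) x →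
      f x ≤ lam * U x + ‖gradient φ x‖ ^ p)
    (hfc : ∀ x y, f x + f y - 2 * f ((1/2 : ℝ) • (x + y)) ≤ c * ‖x - y‖ ^ 2)
    (x₀ y₀ : EuclideanSpace ℝ (Fin n)) :
    U x₀ + U y₀ - 2 * U ((1/2 : ℝ) • (x₀ + y₀)) ≤ c / lam * ‖x₀ - y₀‖ ^ 2 := by
  by_contra hcon
  push Not at hcon
  set A := c / lam with hA
  have hAp : 0 < A := div_pos hc hlam
  set η := U x₀ + U y₀ - 2 * U ((1/2 : ℝ) • (x₀ + y₀)) - A * ‖x₀ - y₀‖ ^ 2 with hη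
  have hηp : 0 < η := by linarith
  have hbd : ∀ g : EuclideanSpace ℝ (Fin n) → ℝ, Continuous g → (∀ x ∉ K, g x = 0) →
      ∃ M, 0 ≤ M ∧ ∀ x, g x ≤ M := by
    intro g hg hgK
    obtain ⟨M, hM⟩ := (hK.image hg).bddAbove
    refine ⟨max M 0, le_max_right _ _, fun x => ?_⟩
    by_cases h : x ∈ K
    · exact (hM ⟨x, h, rfl⟩).trans (le_max_left _ _)
    · rw [hgK x h]; exact le_max_right _ _
  obtain ⟨M, hM0, hM⟩ := hbd U hU hUK
  obtain ⟨Mf, hMf0, hMf⟩ := hbd f hf hfK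
  have huc : UniformContinuous f := by
    apply HasCompactSupport.uniformContinuous_of_continuous _ hf
    exact HasCompactSupport.intro hK hfK
  set σ := lam * η / 4 with hσ
  have hσp : 0 < σ := by positivity
  obtain ⟨δ, hδ, hδf⟩ := Metric.uniformContinuous_iff.1 huc σ hσp
  set B := Mf / δ ^ 2 with hB
  have hB0 : 0 ≤ B := by positivity
  have hfB : ∀ a b, f a - f b ≤ σ + B * ‖a - b‖ ^ 2 := by
    intro a b
    by_cases h : dist a b < δ
    · have := hδf h
      rw [Real.dist_eq] at this
      have h2 := (abs_lt.1 this).2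
      have : 0 ≤ B * ‖a - b‖ ^ 2 := by positivity
      linarith
    · push Not at h
      rw [dist_eq_norm] at h
      have h1 : δ ^ 2 ≤ ‖a - b‖ ^ 2 := by gcongr
      have h2 : B * δ ^ 2 ≤ B * ‖a - b‖ ^ 2 := by gcongr
      have h3 : B * δ ^ 2 = Mf := by rw [hB]; field_simp
      have := hMf a; have := hf0 b
      linarith
  set N := B / (2 * lam) + 1 with hN
  have hNp : 0 < N := by positivity
  set Φ : EuclideanSpace ℝ (Fin n) × EuclideanSpace ℝ (Fin n) × EuclideanSpace ℝ (Fin n) → ℝ :=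
    fun q => U q.1 + U q.2.1 - 2 * U q.2.2 - A * ‖q.1 - q.2.1‖ ^ 2
      - N * ‖q.1 + q.2.1 - (2:ℝ) • q.2.2‖ ^ 2 with hΦ
  have hΦc : Continuous Φ := by fun_prop
  obtain ⟨r, hr0, hr⟩ := hK.isBounded.exists_pos_norm_le
  set a := √(2 * M / A) with ha
  set b := √(2 * M / N) with hb
  set L := 2 * (r + a) + b with hL
  have ha0 : 0 ≤ a := Real.sqrt_nonneg _
  have hb0 : 0 ≤ b := Real.sqrt_nonneg _
  have hout : ∀ q, 0 < Φ q → q ∈ closedBall (0 : EuclideanSpace ℝ (Fin n) × EuclideanSpace ℝ (Fin n) × EuclideanSpace ℝ (Fin n)) L := by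
    rintro ⟨x, y, z⟩ hq
    simp only [hΦ] at hq
    have u1 := hM x; have u2 := hM y; have u3 := hU0 z
    have e1 : 0 ≤ A * ‖x - y‖ ^ 2 := by positivity
    have e2 : 0 ≤ N * ‖x + y - (2:ℝ) • z‖ ^ 2 := by positivity
    have n1 : ‖x - y‖ ≤ a := by
      apply Real.le_sqrt_of_sq_le
      rw [le_div_iff₀ hAp]; linarith
    have n2 : ‖x + y - (2:ℝ) • z‖ ≤ b := by
      apply Real.le_sqrt_of_sq_le
      rw [le_div_iff₀ hNp]; linarith
    have hxy : x ∈ K ∨ y ∈ K := by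
      by_contra h
      push Not at h
      rw [hUK x h.1, hUK y h.2] at hq
      linarith
    have n3 : ‖x‖ ≤ r + a ∧ ‖y‖ ≤ r + a := by
      rcases hxy with h | h
      · have h1 := hr x h
        refine ⟨by linarith, ?_⟩
        have := norm_sub_norm_le y x
        rw [norm_sub_rev] at this
        linarith
      · have h1 := hr y h
        refine ⟨?_, by linarith⟩
        have := norm_sub_norm_le x y
        linarith
    have n4 : ‖z‖ ≤ L := by
      have h1 := norm_sub_norm_le ((2:ℝ) • z) (x + y)
      rw [norm_sub_rev, norm_smul] at h1
      have h2 := norm_add_le x y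
      norm_num at h1
      have := norm_nonneg z
      linarith [n3.1, n3.2]
    rw [mem_closedBall_zero_iff]
    rw [Prod.norm_def, Prod.norm_def]
    refine max_le ?_ (max_le ?_ n4)
    · show ‖x‖ ≤ L
      linarith [n3.1]
    · show ‖y‖ ≤ L
      linarith [n3.2]
  have hΦ0 : Φ (x₀, y₀, (1/2 : ℝ) • (x₀ + y₀)) = η := by
    simp only [hΦ, hη]
    have : x₀ + y₀ - (2:ℝ) • (1/2 : ℝ) • (x₀ + y₀) = 0 := by module
    rw [this]; simp
  have h0mem := hout (x₀, y₀, (1/2 : ℝ) • (x₀ + y₀)) (by rw [hΦ0]; exact hηp)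
  obtain ⟨⟨x, y, z⟩, hqm, hqmax⟩ := (isCompact_closedBall
    (0 : EuclideanSpace ℝ (Fin n) × EuclideanSpace ℝ (Fin n) × EuclideanSpace ℝ (Fin n)) L).exists_isMaxOn
      ⟨_, h0mem⟩ hΦc.continuousOn
  have hge : η ≤ Φ (x, y, z) := by rw [← hΦ0]; exact hqmax h0mem
  have hmax : ∀ q, Φ q ≤ Φ (x, y, z) := by
    intro q
    by_cases h : 0 < Φ q
    · exact hqmax (hout q h)
    · linarith
  have hx := hsub x _ (contDiff_quad A N y (y - (2:ℝ) • z)) (by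
    refine Eventually.of_forall fun x' => ?_
    have := hmax (x', y, z)
    simp only [hΦ] at this
    simp only [← add_sub_assoc]
    linarith)
  have hy := hsub y _ (contDiff_quad A N x (x - (2:ℝ) • z)) (by
    refine Eventually.of_forall fun y' => ?_
    have := hmax (x, y', z)
    simp only [hΦ] at this
    simp only [← add_sub_assoc, add_comm _ x]
    rw [norm_sub_rev x y', norm_sub_rev x y] at this
    linarith)
  have hz := hsup z _ (contDiff_quad (-2 * N) 0 ((1/2 : ℝ) • (x + y)) 0) (by
    refine Eventually.of_forall fun z' => ?_
    have := hmax (x, y, z')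
    simp only [hΦ] at this
    have k : ∀ w : EuclideanSpace ℝ (Fin n), ‖x + y - (2:ℝ) • w‖ ^ 2
        = 4 * ‖w - (1/2 : ℝ) • (x + y)‖ ^ 2 := by
      intro w
      have : x + y - (2:ℝ) • w = (-2 : ℝ) • (w - (1/2 : ℝ) • (x + y)) := by module
      rw [this, norm_smul]; norm_num; ring
    rw [k, k] at this
    simp only [zero_mul, add_zero]
    linarith)
  rw [hasGrad_quad] at hx hy hz
  set px := (2 * A) • (x - y) + (2 * N) • (x + (y - (2:ℝ) • z)) with hpx
  set py := (2 * A) • (y - x) + (2 * N) • (y + (x - (2:ℝ) • z)) with hpy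
  have hpz : (2 * (-2 * N)) • (z - (1/2 : ℝ) • (x + y)) + (2 * (0:ℝ)) • (z + 0)
      = (1/2 : ℝ) • (px + py) := by
    rw [hpx, hpy]; module
  rw [hpz] at hz
  have hcv := norm_rpow_mid (by linarith : 1 ≤ p) px py
  have hm1 := hfc x y
  have hm2 := hfB ((1/2 : ℝ) • (x + y)) z
  have k : ‖(1/2 : ℝ) • (x + y) - z‖ ^ 2 = ‖x + y - (2:ℝ) • z‖ ^ 2 / 4 := by
    have : x + y - (2:ℝ) • z = (2 : ℝ) • ((1/2 : ℝ) • (x + y) - z) := by module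
    rw [this, norm_smul]; norm_num; ring
  rw [k] at hm2
  simp only [hΦ] at hge
  have hAc : lam * A = c := by rw [hA]; field_simp
  have hNc : lam * N = B / 2 + lam := by rw [hN]; field_simp
  have hge2 := mul_le_mul_of_nonneg_left hge hlam.le
  have hsq : 0 ≤ lam * ‖x + y - (2:ℝ) • z‖ ^ 2 := by positivity
  have e : lam * (U x + U y - 2 * U z - A * ‖x - y‖ ^ 2 - N * ‖x + y - (2:ℝ) • z‖ ^ 2)
    = lam * U x + lam * U y - 2 * (lam * U z) - (lam * A) * ‖x - y‖ ^ 2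
      - (lam * N) * ‖x + y - (2:ℝ) • z‖ ^ 2 := by ring
  rw [e, hAc, hNc] at hge2
  have : 0 < lam * η := by positivity
  linarith

lemma u_nonneg {n : ℕ} {Ω : Set (EuclideanSpace ℝ (Fin n))} (hΩb : IsBounded Ω)
    {p lam : ℝ} (hp : 2 < p) (hlam : 0 < lam) {f u : EuclideanSpace ℝ (Fin n) → ℝ}
    (hf_nonneg : ∀ x ∈ closure Ω, 0 ≤ f x) (hu_cont : ContinuousOn u (closure Ω))
    (hu_sup : ViscSupOn1 Ω lam p f u) : ∀ x ∈ closure Ω, 0 ≤ u x := by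
  intro x hx
  obtain ⟨x₀, hx₀, hmin⟩ := hΩb.isCompact_closure.exists_isMinOn ⟨x, hx⟩ hu_cont
  have h := hu_sup x₀ hx₀ (fun _ => 0) contDiff_const (by simpa using hmin.localize)
  have hg : gradient (fun _ : EuclideanSpace ℝ (Fin n) => (0:ℝ)) x₀ = 0 := gradient_fun_const _ _
  rw [hg, norm_zero, Real.zero_rpow (by linarith)] at h
  have h2 := hf_nonneg x₀ hx₀
  have h3 : 0 ≤ lam * u x₀ := by linarith
  have h4 : 0 ≤ u x₀ := nonneg_of_mul_nonneg_right h3 hlam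
  exact h4.trans (hmin hx)

lemma u_le {n : ℕ} {Ω : Set (EuclideanSpace ℝ (Fin n))} (hΩo : IsOpen Ω)
    {p lam : ℝ} {f u : EuclideanSpace ℝ (Fin n) → ℝ}
    (hf_cont : ContinuousOn f (closure Ω)) (hu_cont : ContinuousOn u (closure Ω))
    (hu_sub : ViscSubIn1 Ω lam p f u) : ∀ x ∈ Ω, lam * u x ≤ f x := by
  intro x hx
  by_contra hcon
  push Not at hcon
  have hfx : ContinuousAt f x := (hf_cont.mono subset_closure).continuousAt (hΩo.mem_nhds hx)
  have hux : ContinuousAt u x := (hu_cont.mono subset_closure).continuousAt (hΩo.mem_nhds hx)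
  have hev : ∀ᶠ y in 𝓝 x, y ∈ Ω ∧ f y < lam * u y :=
    (hΩo.eventually_mem hx).and (hfx.eventually_lt (hux.const_mul lam) hcon)
  obtain ⟨r, hr, hball⟩ := Metric.nhds_basis_closedBall.mem_iff.1 hev
  have hcB : IsCompact (closedBall x r) := isCompact_closedBall x r
  have huB : ContinuousOn u (closedBall x r) := hu_cont.mono fun y hy => subset_closure (hball hy).1
  obtain ⟨M, hM⟩ := (hcB.image_of_continuousOn huB).bddAbove
  have hMx : u x ≤ M := hM ⟨x, mem_closedBall_self hr.le, rfl⟩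
  set k := (M - u x + 1) / r ^ 2 with hk
  have hkr : k * r ^ 2 = M - u x + 1 := by rw [hk]; field_simp
  obtain ⟨y, hy, hmax⟩ := hcB.exists_isMaxOn ⟨x, mem_closedBall_self hr.le⟩
    (f := fun y => u y - (k * ‖y - x‖ ^ 2 + 0 * ‖y + 0‖ ^ 2))
    (huB.sub (contDiff_quad k 0 x 0).continuous.continuousOn)
  have hyr : dist y x < r := by
    refine lt_of_le_of_ne (mem_closedBall.1 hy) fun h => ?_
    have h1 := hmax (mem_closedBall_self hr.le)
    simp only [mem_ofPred_eq] at h1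
    rw [dist_eq_norm] at h
    rw [h, hkr] at h1
    have h2 := hM ⟨y, hy, rfl⟩
    simp at h1
    linarith
  have hnb : closedBall x r ∈ 𝓝 y :=
    mem_of_superset (isOpen_ball.mem_nhds (mem_ball.2 hyr)) ball_subset_closedBall
  have h := hu_sub y (hball hy).1 _ (contDiff_quad k 0 x 0)
    ((hmax.isLocalMax hnb).on Ω)
  have h2 : 0 ≤ ‖gradient (fun y => k * ‖y - x‖ ^ 2 + 0 * ‖y + 0‖ ^ 2) y‖ ^ p :=
    Real.rpow_nonneg (norm_nonneg _) _
  have h3 := (hball hy).2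
  linarith

lemma f_semic {n : ℕ} {Ω K : Set (EuclideanSpace ℝ (Fin n))} (hΩo : IsOpen Ω)
    (hK : IsCompact K) (hKΩ : K ⊆ Ω) {f : EuclideanSpace ℝ (Fin n) → ℝ} (hf : Continuous f)
    (hf0 : ∀ x, 0 ≤ f x) (hfK : ∀ x ∉ K, f x = 0) {c : ℝ} (hc : SemicOn f Ω c) :
    ∃ c' > 0, ∀ x y, f x + f y - 2 * f ((1/2 : ℝ) • (x + y)) ≤ c' * ‖x - y‖ ^ 2 := by
  obtain ⟨κ, hκ, hκs⟩ := hK.exists_cthickening_subset_open hΩo hKΩ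
  obtain ⟨M, hM⟩ : ∃ M, ∀ x, f x ≤ M := by
    obtain ⟨M, hM⟩ := (hK.image hf).bddAbove
    refine ⟨max M 0, fun x => ?_⟩
    by_cases h : x ∈ K
    · exact (hM ⟨x, h, rfl⟩).trans (le_max_left _ _)
    · rw [hfK x h]; exact le_max_right _ _
  have hM0 : 0 ≤ M := (hf0 0).trans (hM 0)
  refine ⟨|c| + 2 * M / κ ^ 2 + 1, by positivity, fun x y => ?_⟩
  have hq : 0 ≤ ‖x - y‖ ^ 2 := by positivity
  by_cases h : ‖x - y‖ ≤ κ
  · by_cases hs : ∃ w ∈ segment ℝ x y, w ∈ K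
    · obtain ⟨w, hw, hwK⟩ := hs
      have hseg : segment ℝ x y ⊆ Ω := by
        intro v hv
        apply hκs
        apply mem_cthickening_of_dist_le v w κ K hwK
        rw [segment_eq_image'] at hw hv
        obtain ⟨s, hs, rfl⟩ := hw
        obtain ⟨t, ht, rfl⟩ := hv
        have : x + t • (y - x) - (x + s • (y - x)) = (t - s) • (y - x) := by module
        rw [dist_eq_norm, this, norm_smul, norm_sub_rev y x]
        have : ‖t - s‖ ≤ 1 := by
          rw [Real.norm_eq_abs, abs_le]; constructor <;> linarith [hs.1, hs.2, ht.1, ht.2]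
        calc _ ≤ 1 * ‖x - y‖ := by gcongr
          _ ≤ κ := by linarith
      have h1 := hc x y hseg (1/2) ⟨by norm_num, by norm_num⟩
      have h2 : (1/2 : ℝ) • x + (1 - 1/2 : ℝ) • y = (1/2 : ℝ) • (x + y) := by module
      rw [h2] at h1
      have h3 : c * ‖x - y‖ ^ 2 ≤ |c| * ‖x - y‖ ^ 2 := by gcongr; exact le_abs_self c
      have h4 : 0 ≤ |c| * ‖x - y‖ ^ 2 := by positivity
      have h5 : 0 ≤ 2 * M / κ ^ 2 * ‖x - y‖ ^ 2 := by positivity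
      nlinarith
    · push Not at hs
      rw [hfK x (hs x (left_mem_segment ℝ x y)), hfK y (hs y (right_mem_segment ℝ x y))]
      have := hf0 ((1/2 : ℝ) • (x + y))
      have : 0 ≤ (|c| + 2 * M / κ ^ 2 + 1) * ‖x - y‖ ^ 2 := by positivity
      linarith
  · push Not at h
    have h1 : κ ^ 2 ≤ ‖x - y‖ ^ 2 := by gcongr
    have h2 : 2 * M / κ ^ 2 * κ ^ 2 ≤ 2 * M / κ ^ 2 * ‖x - y‖ ^ 2 := by gcongr
    have h3 : 2 * M / κ ^ 2 * κ ^ 2 = 2 * M := by field_simp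
    have := hf0 ((1/2 : ℝ) • (x + y))
    have := hM x
    have := hM y
    have h4 : 0 ≤ |c| * ‖x - y‖ ^ 2 := by positivity
    nlinarith

lemma cont_of_supp {n : ℕ} {Ω K : Set (EuclideanSpace ℝ (Fin n))} (hΩo : IsOpen Ω)
    (hK : IsCompact K) (hKΩ : K ⊆ Ω) {g : EuclideanSpace ℝ (Fin n) → ℝ} (hg : ContinuousOn g Ω)
    (hgK : ∀ x ∉ K, g x = 0) : Continuous g := by
  rw [continuous_iff_continuousAt]
  intro x
  by_cases h : x ∈ Ω
  · exact hg.continuousAt (hΩo.mem_nhds h)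
  · have hxK : x ∉ K := fun h' => h (hKΩ h')
    have : g =ᶠ[𝓝 x] fun _ => 0 := by
      filter_upwards [hK.isClosed.isOpen_compl.mem_nhds hxK] with y hy using hgK y hy
    exact continuousAt_const.congr this.symm

/-- `u` vanishes off `K`, and is semiconcave (after extension by zero). -/
lemma u_semic {n : ℕ} {Ω K : Set (EuclideanSpace ℝ (Fin n))} (hΩo : IsOpen Ω) (hΩb : IsBounded Ω)
    {p lam : ℝ} (hp : 2 < p) (hlam : 0 < lam) {f u : EuclideanSpace ℝ (Fin n) → ℝ}
    (hf_cont : ContinuousOn f (closure Ω)) (hf_nonneg : ∀ x ∈ closure Ω, 0 ≤ f x)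
    (hK : IsCompact K) (hKΩ : K ⊆ Ω) (hfK : ∀ x ∉ K, f x = 0)
    {c : ℝ} (hc : SemicOn f Ω c) (hu_cont : ContinuousOn u (closure Ω))
    (hu_sub : ViscSubIn1 Ω lam p f u) (hu_sup : ViscSupOn1 Ω lam p f u) :
    (∀ x ∈ frontier Ω, u x = 0) ∧ ∃ A > 0, ∀ x v, x ∈ Ω → x + v ∈ Ω → x - v ∈ Ω →
      u (x + v) + u (x - v) - 2 * u x ≤ A * ‖v‖ ^ 2 := by
  have hn := u_nonneg hΩb hp hlam hf_nonneg hu_cont hu_sup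
  have hl := u_le hΩo hf_cont hu_cont hu_sub
  have huΩ : ∀ x ∈ Ω, x ∉ K → u x = 0 := by
    intro x hx hxK
    have h1 := hl x hx
    rw [hfK x hxK] at h1
    have h2 := hn x (subset_closure hx)
    nlinarith
  have hfc : Continuous f := cont_of_supp hΩo hK hKΩ (hf_cont.mono subset_closure) hfK
  have hf0 : ∀ x, 0 ≤ f x := by
    intro x
    by_cases h : x ∈ K
    · exact hf_nonneg x (subset_closure (hKΩ h))
    · rw [hfK x h]
  constructor
  · intro x hx
    have hxc : x ∈ closure Ω := frontier_subset_closure hx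
    have hxΩ : x ∉ Ω := by rw [hΩo.frontier_eq] at hx; exact hx.2
    have hxK : x ∉ K := fun h => hxΩ (hKΩ h)
    have ht : Tendsto u (𝓝[Ω] x) (𝓝 (u x)) := (hu_cont x hxc).mono_left (nhdsWithin_mono _ subset_closure)
    have : (𝓝[Ω] x).NeBot := mem_closure_iff_nhdsWithin_neBot.1 hxc
    have he : u =ᶠ[𝓝[Ω] x] fun _ => 0 := by
      filter_upwards [self_mem_nhdsWithin,
        nhdsWithin_le_nhds (hK.isClosed.isOpen_compl.mem_nhds hxK)] with y hy hyK using huΩ y hy hyK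
    exact tendsto_nhds_unique (ht.congr' he) tendsto_const_nhds
  · set U := Ω.indicator u with hUdef
    have hUΩ : ∀ x ∈ Ω, U x = u x := fun x hx => indicator_of_mem hx u
    have hUK : ∀ x ∉ K, U x = 0 := by
      intro x hx
      by_cases h : x ∈ Ω
      · rw [hUΩ x h]; exact huΩ x h hx
      · exact indicator_of_notMem h u
    have hUc : Continuous U := cont_of_supp hΩo hK hKΩ
      ((hu_cont.mono subset_closure).congr hUΩ) hUK
    have hU0 : ∀ x, 0 ≤ U x := fun x => indicator_nonneg (fun y hy => hn y (subset_closure hy)) x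
    obtain ⟨c', hc', hfc'⟩ := f_semic hΩo hK hKΩ hfc hf0 hfK hc
    have key := semic_global hK hUc hfc hU0 hf0 hUK hfK hlam hp hc' ?_ ?_ hfc'
    · refine ⟨c' / lam * 4, by positivity, fun x v hx h1 h2 => ?_⟩
      have := key (x + v) (x - v)
      have e1 : (1/2 : ℝ) • (x + v + (x - v)) = x := by module
      have e2 : x + v - (x - v) = (2:ℝ) • v := by module
      rw [e1, e2, hUΩ _ hx, hUΩ _ h1, hUΩ _ h2, norm_smul] at this
      norm_num at this
      linarith [this]
    · intro x φ hφ hmax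
      by_cases h : x ∈ Ω
      · have he : ∀ᶠ y in 𝓝 x, u y = U y := by
          filter_upwards [hΩo.mem_nhds h] with y hy using (hUΩ y hy).symm
        have := hu_sub x h φ hφ (by
          refine IsLocalMax.on ?_ Ω
          filter_upwards [hmax, he] with y h1 h2
          rw [h2, ← hUΩ x h]; exact h1)
        rw [hUΩ x h]; linarith
      · have hxK : x ∉ K := fun h' => h (hKΩ h')
        have he : ∀ᶠ y in 𝓝 x, U y = 0 := by
          filter_upwards [hK.isClosed.isOpen_compl.mem_nhds hxK] with y hy using hUK y hy
        have hm : IsLocalMin φ x := by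
          filter_upwards [hmax, he] with y h1 h2
          rw [h2, hUK x hxK] at h1
          linarith
        have hg : gradient φ x = 0 := by
          rw [gradient, hm.fderiv_eq_zero, map_zero]
        rw [hg, hUK x hxK, hfK x hxK, norm_zero, Real.zero_rpow (by linarith)]
        simp
    · intro x φ hφ hmin
      by_cases h : x ∈ Ω
      · have he : ∀ᶠ y in 𝓝 x, u y = U y := by
          filter_upwards [hΩo.mem_nhds h] with y hy using (hUΩ y hy).symm
        have := hu_sup x (subset_closure h) φ hφ (by
          refine IsLocalMin.on ?_ _
          filter_upwards [hmin, he] with y h1 h2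
          rw [h2, ← hUΩ x h]; exact h1)
        rw [hUΩ x h]; linarith
      · have hxK : x ∉ K := fun h' => h (hKΩ h')
        rw [hUK x hxK, hfK x hxK]
        have := Real.rpow_nonneg (norm_nonneg (gradient φ x)) p
        linarith

lemma exists_local_ext {n : ℕ} {Ω : Set (EuclideanSpace ℝ (Fin n))} (hΩo : IsOpen Ω)
    {w : EuclideanSpace ℝ (Fin n) → ℝ} (hw : ContDiffOn ℝ 2 w Ω) {x : EuclideanSpace ℝ (Fin n)}
    (hx : x ∈ Ω) : ∃ ψ : EuclideanSpace ℝ (Fin n) → ℝ, ContDiff ℝ 1 ψ ∧ ψ =ᶠ[𝓝 x] w := by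
  obtain ⟨r, hr, hball⟩ := Metric.nhds_basis_closedBall.mem_iff.1 (hΩo.mem_nhds hx)
  let χ : ContDiffBump x := ⟨r / 2, r, by linarith, by linarith⟩
  refine ⟨fun y => χ y * w y, ?_, ?_⟩
  · rw [contDiff_iff_contDiffAt]
    intro y
    by_cases hy : y ∈ Ω
    · exact (χ.contDiff.contDiffAt).mul
        ((hw.contDiffAt (hΩo.mem_nhds hy)).of_le (by norm_num))
    · have hyb : y ∉ closedBall x r := fun h => hy (hball h)
      have : (fun y => χ y * w y) =ᶠ[𝓝 y] fun _ => 0 := by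
        filter_upwards [isClosed_closedBall.isOpen_compl.mem_nhds hyb] with z hz
        have hz' : r ≤ dist z x := by
          have : ¬ dist z x ≤ r := hz
          linarith
        rw [χ.zero_of_le_dist hz', zero_mul]
      exact contDiffAt_const.congr_of_eventuallyEq this
  · filter_upwards [χ.eventuallyEq_one] with y hy
    rw [hy]; simp

/-- Improved upper bound
`max_{cl Ω} (u^ε − u) ≤ (1/λ + 2^{α_p}/α_p)·ε^{1 − α_p/2}` for nonnegative, semiconcave data
with compact support contained in `Ω`, where `α_p = (p−2)/(p−1)`.
The `C²`-boundary assumption is encoded by `0 < δ_Ω`. -/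
theorem upper_rate_semiconcave_data {n : ℕ} (Ω : Set (EuclideanSpace ℝ (Fin n)))
    (hΩo : IsOpen Ω) (hΩb : IsBounded Ω) (hΩne : Ω.Nonempty)
    (hC2 : 0 < deltaOm Ω)
    (p lam : ℝ) (hp : 2 < p) (hlam : 0 < lam)
    (f : EuclideanSpace ℝ (Fin n) → ℝ) (hf_cont : ContinuousOn f (closure Ω))
    (hf_nonneg : ∀ x ∈ closure Ω, 0 ≤ f x)
    (hf_supp : ∃ K : Set (EuclideanSpace ℝ (Fin n)),
      IsCompact K ∧ K ⊆ Ω ∧ ∀ x, x ∉ K → f x = 0)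
    (hf_sc : ∃ c : ℝ, SemicOn f Ω c)
    -- `u` is the state-constraint viscosity solution of `λu + |Du|^p = f`
    (u : EuclideanSpace ℝ (Fin n) → ℝ) (hu_cont : ContinuousOn u (closure Ω))
    (hu_sub : ViscSubIn1 Ω lam p f u) (hu_sup : ViscSupOn1 Ω lam p f u)
    -- `uε ε` is the maximal solution of the state-constraint problem for
    -- `λu + |Du|^p − εΔu = f`
    (uε : ℝ → EuclideanSpace ℝ (Fin n) → ℝ)
    (huε : ∀ ε : ℝ, 0 < ε →
      ContinuousOn (uε ε) (closure Ω) ∧ ClassicalSolIn Ω lam p ε f (uε ε) ∧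
      ViscSupOn Ω lam p ε f (uε ε) ∧ BdryStrict Ω ((p - 2) / (p - 1)) (uε ε)) :
    ∃ ε₀ > (0:ℝ), ∀ ε : ℝ, 0 < ε → ε < ε₀ → ∀ x ∈ closure Ω,
      uε ε x - u x ≤
        (1 / lam + (2 : ℝ) ^ ((p - 2) / (p - 1)) / ((p - 2) / (p - 1)))
          * ε ^ (1 - ((p - 2) / (p - 1)) / 2) := by
  obtain ⟨K, hK, hKΩ, hfK⟩ := hf_supp
  obtain ⟨c, hc⟩ := hf_sc
  obtain ⟨hu0, A, hA, huA⟩ := u_semic hΩo hΩb hp hlam hf_cont hf_nonneg hK hKΩ hfK hc hu_cont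
    hu_sub hu_sup
  obtain ⟨R, hR, hFne, hRball⟩ := int_ball hΩo hΩb hΩne hC2 hK hKΩ
  have hdc : Continuous (dBdry Ω) := continuous_infDist_pt _
  set α := (p - 2) / (p - 1) with hα
  have hp1 : 0 < p - 1 := by linarith
  have hα0 : 0 < α := div_pos (by linarith) hp1
  have hα1 : α < 1 := by rw [hα, div_lt_one hp1]; linarith
  have hαp : (α - 1) * p = α - 2 := by rw [hα]; field_simp; ring
  set C := 1 / lam + (2:ℝ) ^ α / α with hC
  have hCp : 0 < C := by positivity
  have hsq : Tendsto (fun ε : ℝ => √ε) (𝓝 0) (𝓝 0) := by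
    simpa using Real.continuous_sqrt.tendsto 0
  have hev : ∀ᶠ ε in 𝓝 (0:ℝ), √ε * (n * 2 / R) ≤ α / 4 ∧ 6 * p * √ε / R ≤ α / 2 ∧
      (n * A / lam) * ε ^ (α / 2) ≤ C := by
    have t1 : Tendsto (fun ε : ℝ => √ε * (n * 2 / R)) (𝓝 0) (𝓝 0) := by
      simpa using hsq.mul_const (n * 2 / R)
    have t2 : Tendsto (fun ε : ℝ => 6 * p * √ε / R) (𝓝 0) (𝓝 0) := by
      simpa using (hsq.const_mul (6 * p)).div_const R
    have t3 : Tendsto (fun ε : ℝ => (n * A / lam) * ε ^ (α / 2)) (𝓝 0) (𝓝 0) := by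
      have := (Real.continuousAt_rpow_const 0 (α / 2) (Or.inr (by positivity))).tendsto
      rw [Real.zero_rpow (by positivity)] at this
      simpa using this.const_mul (n * A / lam)
    filter_upwards [t1.eventually_le_const (u := α / 4) (by positivity),
      t2.eventually_le_const (u := α / 2) (by positivity),
      t3.eventually_le_const (u := C) hCp] with ε h1 h2 h3 using ⟨h1, h2, h3⟩
  obtain ⟨ε₀, hε₀, hball⟩ := Metric.eventually_nhds_iff.1 hev
  refine ⟨ε₀, hε₀, fun ε hε hεlt => ?_⟩
  obtain ⟨c1, c2, c3⟩ := hball (show dist ε 0 < ε₀ by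
    rw [Real.dist_eq, sub_zero, abs_of_pos hε]; exact hεlt)
  obtain ⟨hcont, ⟨hreg, heq⟩, -, -⟩ := huε ε hε
  obtain ⟨x, hx, hmax⟩ := hΩb.isCompact_closure.exists_isMaxOn hΩne.closure (hcont.sub hu_cont)
  suffices hs : uε ε x - u x ≤ C * ε ^ (1 - α / 2) by
    intro y hy
    exact (hmax hy).trans hs
  by_cases hxΩ : x ∈ Ω
  · obtain ⟨ψ, hψ, hψe⟩ := exists_local_ext hΩo hreg hxΩ
    have hsup := hu_sup x hx ψ hψ (by
      have h1 : ∀ᶠ y in 𝓝[closure Ω] x, ψ y = uε ε y := nhdsWithin_le_nhds hψe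
      filter_upwards [h1, self_mem_nhdsWithin] with y hy1 hy2
      have := hmax hy2
      simp only [mem_ofPred_eq, Pi.sub_apply] at this
      rw [hy1, hψe.self_of_nhds]
      linarith)
    have hg : gradient ψ x = gradient (uε ε) x := by
      rw [gradient, gradient, hψe.fderiv_eq]
    rw [hg] at hsup
    have heqx := heq x hxΩ
    have hlap : lapl (uε ε) x ≤ n * A := by
      apply lapl_le_of_semic (hreg.contDiffAt (hΩo.mem_nhds hxΩ))
      have t1 : Tendsto (fun v => x + v) (𝓝 0) (𝓝 x) := by
        have : Continuous (fun v => x + v) := by fun_prop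
        simpa using this.tendsto 0
      have t2 : Tendsto (fun v => x - v) (𝓝 0) (𝓝 x) := by
        have : Continuous (fun v => x - v) := by fun_prop
        simpa using this.tendsto 0
      filter_upwards [t1.eventually (hΩo.eventually_mem hxΩ),
        t2.eventually (hΩo.eventually_mem hxΩ)] with v h1 h2
      have a1 := hmax (subset_closure h1)
      have a2 := hmax (subset_closure h2)
      simp only [mem_ofPred_eq, Pi.sub_apply] at a1 a2
      have a3 := huA x v hxΩ h1 h2
      linarith
    have h1 : lam * (uε ε x - u x) ≤ ε * (n * A) := by
      have := mul_le_mul_of_nonneg_left hlap hε.le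
      linarith
    have h2 : uε ε x - u x ≤ ε * (n * A) / lam := by
      rw [le_div_iff₀ hlam]; linarith
    have h3 : ε = ε ^ (1 - α / 2) * ε ^ (α / 2) := by
      rw [← Real.rpow_add hε]; simp
    have h4 : ε * (n * A) / lam = (n * A / lam) * ε ^ (α / 2) * ε ^ (1 - α / 2) := by
      conv_lhs => rw [h3]
      ring
    rw [h4] at h2
    exact h2.trans (mul_le_mul_of_nonneg_right c3 (Real.rpow_nonneg hε.le _))
  · have hxF : x ∈ frontier Ω := by rw [hΩo.frontier_eq]; exact ⟨hx, hxΩ⟩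
    rw [hu0 x hxF, sub_zero]
    have ht : Tendsto (uε ε) (𝓝[Ω] x) (𝓝 (uε ε x)) :=
      (hcont x hx).mono_left (nhdsWithin_mono _ subset_closure)
    have : (𝓝[Ω] x).NeBot := mem_closure_iff_nhdsWithin_neBot.1 hx
    refine le_of_tendsto ht ?_
    have hd0 : dBdry Ω x = 0 := infDist_zero_of_mem hxF
    have hd : ∀ᶠ y in 𝓝 x, dBdry Ω y < R :=
      (hdc.tendsto x).eventually (gt_mem_nhds (by rw [hd0]; exact hR))
    filter_upwards [self_mem_nhdsWithin, nhdsWithin_le_nhds hd] with y hy hyd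
    obtain ⟨z, hyz, hzΩ, hzK⟩ := hRball y hy hyd
    exact ball_bound z hR hlam hε hα0 hα1 hp hαp c1 c2 (uε ε) (hreg.mono hzΩ)
      (fun w hw => by rw [heq w (hzΩ hw), hfK w (hzK w hw)]) y hyz
end
end
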